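/- arXiv:1810.00311 — 2 statements merged into one kernel-verified Lean document; each statement's English description precedes it below -/
import Mathlib

section
/- Fix integers $d,m\ge 1$ and let $M=\{1,\dots,m\}$. For each $i\in M$ let $b(\cdot,i):\mathbb R^d\to\mathbb R^d$ and $\sigma(\cdot,i):\mathbb R^d\to\mathbb R^{d\times d}$ be continuous with $\sum_{k,l}|\sigma_{kl}(x,i)|+\sum_k|b_k(x,i)|\le c(1+|x|)$ for some $c>0$, and suppose that $a:=\sigma\sigma^{\top}$ is locally uniformly elliptic: for every bounded domain (nonempty connected bounded open set) $D'\subset\mathbb R^d$ there is $\kappa_0\in(0,1]$ with $\kappa_0|\xi|^2\le\xi^{\top}a(x,i)\xi\le\kappa_0^{-1}|\xi|^2$ for all $\xi\in\mathbb R^d$, $x\in D'$, $i\in M$. Let $Q(x)=(q_{ij}(x))_{i,j\in M}$ have bounded Borel entries with $q_{ij}\ge 0$ for $i\ne j$ and $\sum_{j}q_{ij}=0$. Let $\pi_i(x,dz)=\tilde\pi_i(x,z)\,dz$ be measures on $\mathbb R^d$, with $\tilde\pi_i\ge 0$ Borel in $(x,z)$, such that $\int(1\wedge|z|^2)\,\pi_i(x,dz)<\infty$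 for all $x,i$; $\sup_{x,i}\pi_i(x,B(0,1)^c)<\infty$; $\int_{B(0,1)}|z|^2\,\pi_i(x,dz)\le c(1+|x|^2)$ for some $c>0$ and all $x,i$; for every integer $n\ge 1$ there is a $\sigma$-finite measure $\Pi_n$ with $\int(1\wedge|z|^2)\,\Pi_n(dz)<\infty$ and $\pi_i(x,\cdot)\le\Pi_n$ for all $x\in B(0,n)$, $i\in M$; and there are $\kappa_2,\beta>0$ and, for each $r\in(0,1)$, a number $\alpha_r$ with $1<\alpha_r<\kappa_2r^{-\beta}$ such that $\tilde\pi_i(x,z-x)\le\alpha_r\tilde\pi_i(y,z-y)$ for all $x_0\in\mathbb R^d$, $x,y\in B(x_0,r/2)$, $z\in B(x_0,r)^c$, $i\in M$. For $f:\mathbb R^d\times M\to\mathbb R$ with $f(\cdot,i)\in C^2(\mathbb R^d)$ for each $i$, put $$Gf(x,i)=\tfrac12\sum_{k,l}a_{kl}(x,i)\frac{\partial^2 f(x,i)}{\partial x_k\partial x_l}+\sum_k b_k(x,i)\frac{\partial f(x,i)}{\partial x_k}+\int_{\mathbb R^d}\bigl[f(x+z,i)-f(x,i)-\nabla f(x,i)\cdot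 z\,\mathbf 1_{\{|z|<1\}}\bigr]\pi_i(x,dz)+\sum_{j\in M}q_{ij}(x)f(x,j).$$ Let $(X(t),\Lambda(t))_{t\ge 0}$ be an $\mathbb R^d\times M$-valued càdlàg process whose laws $(P_{x,i})$ solve the martingale problem for $(G,C_b^2(\mathbb R^d))$: $P_{x,i}(X(0)=x,\Lambda(0)=i)=1$ and, for every $f$ such that each $f(\cdot,i)$ is $C^2$ with bounded partial derivatives of orders $0,1,2$, the process $f(X(t),\Lambda(t))-f(x,i)-\int_0^tGf(X(s),\Lambda(s))\,ds$ is a $P_{x,i}$-martingale. For $U\subset\mathbb R^d\times M$ let $\sigma_U=\inf\{t\ge 0:(X(t),\Lambda(t))\in U\}$, and for $D\subset\mathbb R^d$ let $\sigma_D=\sigma_{D\times M}$ ($\inf\emptyset=\infty$). Let $D\subset\mathbb R^d$ be a bounded domain and $U=D\times M$. Suppose that for each $i\in M$ there is a nonnegative function $V(\cdot,i)\in C^2(\mathbb R^d)$ such that, for all $(x,i)\in D^c\times M$, the integral with respect to $\pi_i(x,dz)$ in $GV(x,i)$ converges absolutely and $GV(x,i)\le -1$. Then the process is positive recurrent with respect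 to $U$, that is, $P_{x,i}(\sigma_U<\infty)=1$ and $E_{x,i}[\sigma_U]<\infty$ for every $(x,i)\in U^c$; moreover, $E_{x,i}[\sigma_D]\le V(x,i)<\infty$ for every $(x,i)\in U^c$. -/
open MeasureTheory Set Filter Metric Matrix
open scoped NNReal ENNReal Topology

noncomputable section

/-- Euclidean state space `ℝ^d`. -/
abbrev Rd (d : ℕ) : Type := EuclideanSpace ℝ (Fin d)

/-- A bounded domain of `ℝ^d`: a nonempty connected bounded open set. -/
def BddDomain {d : ℕ} (D : Set (Rd d)) : Prop :=
  IsOpen D ∧ IsConnected D ∧ Bornology.IsBounded D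

/-- The coefficients of a regime-switching jump diffusion on `ℝ^d × {1,…,m}`. -/
structure SwitchingCoeff (d m : ℕ) where
  /-- the drift `b(x,i)` -/
  b : Rd d → Fin m → Rd d
  /-- the matrix `σ(x,i)` -/
  sig : Rd d → Fin m → Matrix (Fin d) (Fin d) ℝ
  /-- the switching rates `q_{ij}(x)` -/
  q : Rd d → Fin m → Fin m → ℝ
  /-- the jump density `π̃_i(x,z)`, as a function of `x`, `i`, `z` -/
  pit : Rd d → Fin m → Rd d → ℝ

namespace SwitchingCoeff

variable {d m : ℕ}

/-- The diffusion matrix `a = σ σᵀ`. -/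
def a (c : SwitchingCoeff d m) (x : Rd d) (i : Fin m) : Matrix (Fin d) (Fin d) ℝ :=
  c.sig x i * (c.sig x i)ᵀ

/-- The jump measure `π_i(x,dz) = π̃_i(x,z) dz`. -/
def jump (c : SwitchingCoeff d m) (x : Rd d) (i : Fin m) : Measure (Rd d) :=
  volume.withDensity fun z => ENNReal.ofReal (c.pit x i z)

/-- The integrand `f(x+z,i) − f(x,i) − ∇f(x,i)·z 1_{|z|<1}` of the jump part of the generator. -/
def jumpIntegrand (f : Rd d → Fin m → ℝ) (x : Rd d) (i : Fin m) (z : Rd d) : ℝ :=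
  f (x + z) i - f x i - (if ‖z‖ < 1 then fderiv ℝ (fun y => f y i) x z else 0)

/-- The generator
`Gf(x,i) = ½ Σ a_{kl} ∂²f/∂x_k∂x_l + Σ b_k ∂f/∂x_k
  + ∫ [f(x+z,i) − f(x,i) − ∇f(x,i)·z 1_{|z|<1}] π_i(x,dz) + Σ_j q_{ij}(x) f(x,j)`.
It has its mathematical meaning only where the jump integral converges. -/
def gen (c : SwitchingCoeff d m) (f : Rd d → Fin m → ℝ) (x : Rd d) (i : Fin m) : ℝ :=
  (1 / 2) * ∑ k, ∑ l, c.a x i k l *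
      iteratedFDeriv ℝ 2 (fun y => f y i) x
        ![EuclideanSpace.single k (1 : ℝ), EuclideanSpace.single l (1 : ℝ)]
    + ∑ k, c.b x i k * fderiv ℝ (fun y => f y i) x (EuclideanSpace.single k (1 : ℝ))
    + ∫ z, jumpIntegrand f x i z ∂(c.jump x i)
    + ∑ j, c.q x i j * f x j

/-- The standing assumptions on the coefficients. -/
structure Admissible (c : SwitchingCoeff d m) : Prop where
  sig_cont : ∀ i, Continuous fun x => c.sig x i
  b_cont : ∀ i, Continuous fun x => c.b x i
  growth : ∃ C > (0 : ℝ), ∀ x i,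
    (∑ k, ∑ l, |c.sig x i k l|) + ∑ k, |c.b x i k| ≤ C * (1 + ‖x‖)
  q_meas : ∀ i j, Measurable fun x => c.q x i j
  q_bdd : ∀ i j, ∃ C : ℝ, ∀ x, |c.q x i j| ≤ C
  q_nonneg : ∀ x i j, i ≠ j → 0 ≤ c.q x i j
  q_rowsum : ∀ x i, ∑ j, c.q x i j = 0
  /-- local uniform ellipticity of `a = σσᵀ` -/
  ellipticity : ∀ D : Set (Rd d), BddDomain D →
    ∃ κ₀ ∈ Set.Ioc (0 : ℝ) 1, ∀ x ∈ D, ∀ (i : Fin m) (ξ : Rd d),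
      κ₀ * ‖ξ‖ ^ 2 ≤ ∑ k, ∑ l, ξ k * c.a x i k l * ξ l ∧
      ∑ k, ∑ l, ξ k * c.a x i k l * ξ l ≤ κ₀⁻¹ * ‖ξ‖ ^ 2
  pit_nonneg : ∀ x i z, 0 ≤ c.pit x i z
  pit_meas : ∀ i, Measurable fun p : Rd d × Rd d => c.pit p.1 i p.2
  levy_integrable : ∀ x i,
    (∫⁻ z, ENNReal.ofReal (min 1 (‖z‖ ^ 2)) ∂(c.jump x i)) < ⊤
  bigjump_bdd : ∃ C : ℝ≥0∞, C < ⊤ ∧ ∀ x i, c.jump x i ((Metric.ball (0 : Rd d) 1)ᶜ) ≤ C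
  smalljump : ∃ C > (0 : ℝ), ∀ x i,
    (∫⁻ z in Metric.ball (0 : Rd d) 1, ENNReal.ofReal (‖z‖ ^ 2) ∂(c.jump x i))
      ≤ ENNReal.ofReal (C * (1 + ‖x‖ ^ 2))
  domination : ∀ n : ℕ, 1 ≤ n → ∃ Pin : Measure (Rd d), SigmaFinite Pin ∧
    (∫⁻ z, ENNReal.ofReal (min 1 (‖z‖ ^ 2)) ∂Pin) < ⊤ ∧
    ∀ x ∈ Metric.ball (0 : Rd d) n, ∀ i, c.jump x i ≤ Pin
  comparability : ∃ κ₂ > (0 : ℝ), ∃ β > (0 : ℝ), ∀ r ∈ Set.Ioo (0 : ℝ) 1, ∃ αr : ℝ,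
    1 < αr ∧ αr < κ₂ * r ^ (-β) ∧
    ∀ (x₀ x y z : Rd d) (i : Fin m), x ∈ Metric.ball x₀ (r / 2) → y ∈ Metric.ball x₀ (r / 2) →
      z ∉ Metric.ball x₀ r → c.pit x i (z - x) ≤ αr * c.pit y i (z - y)

/-- `V` is a Lyapunov function for condition (C1) with respect to `D × M`: `V(·,i)` is nonnegative
and `C²`, and `GV ≤ −1` on `Dᶜ × M`. For such `V` the jump integral in `GV` always has a value in
`(−∞, +∞]`, so `GV(x,i) ≤ −1` includes its convergence. -/
structure IsLyapC1 (c : SwitchingCoeff d m) (D : Set (Rd d)) (V : Rd d → Fin m → ℝ) : Prop where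
  contDiff : ∀ i, ContDiff ℝ 2 fun y => V y i
  nonneg : ∀ x i, 0 ≤ V x i
  integrable : ∀ x ∉ D, ∀ i, Integrable (jumpIntegrand V x i) (c.jump x i)
  gen_le : ∀ x ∉ D, ∀ i, c.gen V x i ≤ -1

end SwitchingCoeff

/-- `f(·,i) ∈ C_b²(ℝ^d)` for each `i`: `C²`, with bounded partial derivatives up to order two. -/
def IsCb2 {d m : ℕ} (f : Rd d → Fin m → ℝ) : Prop :=
  ∀ i, ContDiff ℝ 2 (fun y => f y i) ∧
    ∃ C : ℝ, ∀ x, |f x i| ≤ C ∧ ‖fderiv ℝ (fun y => f y i) x‖ ≤ C ∧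
      ‖iteratedFDeriv ℝ 2 (fun y => f y i) x‖ ≤ C

/-- A càdlàg adapted process `(X(t), Λ(t))` on `ℝ^d × M`, on a filtered measurable space, with
laws `P_{x,i}` that solve the martingale problem for `(G, C_b²(ℝ^d))` started at `(x,i)`. -/
structure SwitchingJumpDiffusion {d m : ℕ} (c : SwitchingCoeff d m)
    (Ω : Type*) [mΩ : MeasurableSpace Ω] where
  /-- the filtration -/
  ℱ : Filtration ℝ≥0 mΩ
  /-- the continuous component -/
  X : ℝ≥0 → Ω → Rd d
  /-- the switching component -/
  Λ : ℝ≥0 → Ω → Fin m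
  /-- the laws `P_{x,i}` -/
  P : Rd d → Fin m → Measure Ω
  prob : ∀ x i, IsProbabilityMeasure (P x i)
  X_adapted : ∀ t, Measurable[ℱ t] (X t)
  Λ_adapted : ∀ t, Measurable[ℱ t] (Λ t)
  cadlag_right : ∀ ω (t : ℝ≥0),
    ContinuousWithinAt (fun s => (X s ω, Λ s ω)) (Set.Ici t) t
  cadlag_left : ∀ ω (t : ℝ≥0), 0 < t →
    ∃ L : Rd d × Fin m, Tendsto (fun s => (X s ω, Λ s ω)) (𝓝[<] t) (𝓝 L)
  init : ∀ x i, P x i {ω | X 0 ω = x ∧ Λ 0 ω = i} = 1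
  martingale_problem : ∀ f : Rd d → Fin m → ℝ, IsCb2 f → ∀ x i, Martingale
    (fun t ω => f (X t ω) (Λ t ω) - f x i -
      ∫ u in Set.Ioc (0 : ℝ) (t : ℝ), c.gen f (X u.toNNReal ω) (Λ u.toNNReal ω))
    ℱ (P x i)

/-- First hitting time (valued in `ℝ≥0∞`) of a set `U` by the process `Z`:
`σ_U = inf{t ≥ 0 : Z(t) ∈ U}`, with `inf ∅ = ∞`. -/
def hit {Ω α : Type*} (Z : ℝ≥0 → Ω → α) (U : Set α) (ω : Ω) : ℝ≥0∞ :=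
  ⨅ (t : ℝ≥0) (_ : Z t ω ∈ U), (t : ℝ≥0∞)

namespace SwitchingJumpDiffusion

variable {d m : ℕ} {c : SwitchingCoeff d m} {Ω : Type*} [MeasurableSpace Ω]

/-- The first entrance time `σ_U` of `(X,Λ)` into `U ⊆ ℝ^d × M`. -/
def sigmaZ (s : SwitchingJumpDiffusion c Ω) (U : Set (Rd d × Fin m)) : Ω → ℝ≥0∞ :=
  hit (fun t ω => (s.X t ω, s.Λ t ω)) U

/-- The first entrance time `σ_D = inf{t ≥ 0 : X(t) ∈ D}` of the continuous component. -/
def sigmaX (s : SwitchingJumpDiffusion c Ω) (D : Set (Rd d)) : Ω → ℝ≥0∞ :=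
  hit s.X D

/-- `(X,Λ)` is recurrent with respect to `U`: `P_{x,i}(σ_U < ∞) = 1` for `(x,i) ∈ Uᶜ`. -/
def Recurrent (s : SwitchingJumpDiffusion c Ω) (U : Set (Rd d × Fin m)) : Prop :=
  ∀ x i, (x, i) ∉ U → s.P x i {ω | s.sigmaZ U ω < ⊤} = 1

/-- `(X,Λ)` is positive recurrent with respect to `U`: it is recurrent, and `E_{x,i}[σ_U] < ∞`
for `(x,i) ∈ Uᶜ`. -/
def PosRecurrent (s : SwitchingJumpDiffusion c Ω) (U : Set (Rd d × Fin m)) : Prop :=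
  s.Recurrent U ∧ ∀ x i, (x, i) ∉ U → (∫⁻ ω, s.sigmaZ U ω ∂(s.P x i)) < ⊤

end SwitchingJumpDiffusion

end

/-! ### The generator on compactly supported `C²` functions -/

/-- Second order Taylor bound for a compactly supported `C²` function. -/
lemma exists_taylor_bound_of_hasCompactSupport {E : Type*} [NormedAddCommGroup E]
    [NormedSpace ℝ E] {g : E → ℝ} (hg : ContDiff ℝ 2 g) (hs : HasCompactSupport g) :
    ∃ C : ℝ, 0 ≤ C ∧ ∀ x z, |g (x + z) - g x - fderiv ℝ g x z| ≤ C * ‖z‖ ^ 2 := by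
  have h1 : ContDiff ℝ 1 (fderiv ℝ g) := hg.fderiv_right (by norm_num)
  obtain ⟨C, hC⟩ := h1.lipschitzWith_of_hasCompactSupport (hs.fderiv ℝ) one_ne_zero
  refine ⟨C, C.2, fun x z => ?_⟩
  have hd : Differentiable ℝ g := hg.differentiable (by norm_num)
  have key := Convex.norm_image_sub_le_of_norm_fderiv_le' (𝕜 := ℝ) (f := g)
    (s := closedBall x ‖z‖) (C := C * ‖z‖) (φ := fderiv ℝ g x) (x := x) (y := x + z)
    (fun y _ => hd y) (fun y hy => ?_) (convex_closedBall x ‖z‖)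
    (mem_closedBall_self (norm_nonneg z)) (by simp [mem_closedBall, dist_eq_norm])
  · simpa [Real.norm_eq_abs, pow_two, mul_assoc] using key
  · have h2 := hC.dist_le_mul y x
    rw [dist_eq_norm] at h2
    exact h2.trans (mul_le_mul_of_nonneg_left (mem_closedBall.1 hy) C.2)

namespace SwitchingCoeff

variable {d m : ℕ} {c : SwitchingCoeff d m} {f : Rd d → Fin m → ℝ}

lemma measurable_jumpIntegrand_uncurry {i : Fin m} (hf : ContDiff ℝ 2 fun y => f y i) :
    Measurable fun p : Rd d × Rd d => jumpIntegrand f p.1 i p.2 := by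
  unfold jumpIntegrand
  have hc : Continuous fun y => f y i := hf.continuous
  have hd : Continuous fun p : Rd d × Rd d => fderiv ℝ (fun y => f y i) p.1 p.2 :=
    ((hf.continuous_fderiv (by norm_num)).comp continuous_fst).clm_apply continuous_snd
  refine ((hc.comp (continuous_fst.add continuous_snd)).measurable.sub
    (hc.comp continuous_fst).measurable).sub ?_
  exact Measurable.ite (measurableSet_lt continuous_snd.norm.measurable measurable_const)
    hd.measurable measurable_const

lemma measurable_jumpIntegrand {i : Fin m} (hf : ContDiff ℝ 2 fun y => f y i) (x : Rd d) :
    Measurable (jumpIntegrand f x i) :=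
  (measurable_jumpIntegrand_uncurry hf).comp measurable_prodMk_left

/-- The jump part of the generator is absolutely integrable on compactly supported `C²` functions,
uniformly in the starting point. -/
lemma Admissible.exists_lintegral_jumpIntegrand_le (hc : c.Admissible) {i : Fin m}
    (hf : ContDiff ℝ 2 fun y => f y i) (hs : HasCompactSupport fun y => f y i) :
    ∃ C : ℝ≥0∞, C < ⊤ ∧ ∀ x, ∫⁻ z, ‖jumpIntegrand f x i z‖ₑ ∂(c.jump x i) ≤ C := by
  obtain ⟨C₂, hC₂, hT⟩ := exists_taylor_bound_of_hasCompactSupport hf hs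
  obtain ⟨C₀, hC₀⟩ := hs.exists_bound_of_continuous hf.continuous
  obtain ⟨B, hB, hbig⟩ := hc.bigjump_bdd
  obtain ⟨S, hS, hsmall⟩ := hc.smalljump
  obtain ⟨R, hR0, hR⟩ : ∃ R : ℝ, 0 ≤ R ∧ tsupport (fun y => f y i) ⊆ closedBall 0 R := by
    obtain ⟨R, hR⟩ := hs.isCompact.isBounded.subset_closedBall (0 : Rd d)
    exact ⟨max R 0, le_max_right _ _, hR.trans (closedBall_subset_closedBall (le_max_left _ _))⟩
  have hzero : ∀ y : Rd d, R < ‖y‖ → y ∉ tsupport fun y => f y i := fun y hy hy' => by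
    have := hR hy'
    rw [mem_closedBall, dist_zero_right] at this
    linarith
  refine ⟨ENNReal.ofReal C₂ * ENNReal.ofReal (S * (1 + (R + 1) ^ 2)) +
    ENNReal.ofReal (2 * C₀) * B, ?_, fun x => ?_⟩
  · exact ENNReal.add_lt_top.2 ⟨ENNReal.mul_lt_top ENNReal.ofReal_lt_top ENNReal.ofReal_lt_top,
      ENNReal.mul_lt_top ENNReal.ofReal_lt_top hB⟩
  rw [← lintegral_add_compl _ (measurableSet_ball (x := (0 : Rd d)) (ε := 1))]
  refine add_le_add ?_ ?_
  · by_cases hx : ‖x‖ ≤ R + 1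
    · calc ∫⁻ z in ball 0 1, ‖jumpIntegrand f x i z‖ₑ ∂(c.jump x i)
          ≤ ∫⁻ z in ball 0 1, ENNReal.ofReal C₂ * ENNReal.ofReal (‖z‖ ^ 2) ∂(c.jump x i) := by
            refine setLIntegral_mono' measurableSet_ball fun z hz => ?_
            rw [← ENNReal.ofReal_mul hC₂, Real.enorm_eq_ofReal_abs]
            refine ENNReal.ofReal_le_ofReal ?_
            have : ‖z‖ < 1 := by simpa using hz
            simpa [jumpIntegrand, this] using hT x z
        _ = ENNReal.ofReal C₂ * ∫⁻ z in ball 0 1, ENNReal.ofReal (‖z‖ ^ 2) ∂(c.jump x i) :=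
            lintegral_const_mul' _ _ ENNReal.ofReal_ne_top
        _ ≤ _ := by
            gcongr
            refine (hsmall x i).trans (ENNReal.ofReal_le_ofReal ?_)
            gcongr
    · push Not at hx
      have : ∫⁻ z in ball 0 1, ‖jumpIntegrand f x i z‖ₑ ∂(c.jump x i) = 0 := by
        rw [← lintegral_zero (μ := (c.jump x i).restrict (ball 0 1))]
        refine setLIntegral_congr_fun measurableSet_ball fun z hz => ?_
        have hz1 : ‖z‖ < 1 := by simpa using hz
        have hx' : x ∉ tsupport fun y => f y i := hzero x (by linarith)
        have hxz : x + z ∉ tsupport fun y => f y i := hzero _ (by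
          have := norm_sub_le (x + z) z
          simp only [add_sub_cancel_right] at this
          linarith)
        have e1 : f x i = 0 := image_eq_zero_of_notMem_tsupport (f := fun y => f y i) hx'
        have e2 : f (x + z) i = 0 := image_eq_zero_of_notMem_tsupport (f := fun y => f y i) hxz
        have e3 : fderiv ℝ (fun y => f y i) x = 0 :=
          image_eq_zero_of_notMem_tsupport fun h => hx' (tsupport_fderiv_subset ℝ h)
        simp [jumpIntegrand, e1, e2, e3]
      rw [this]
      exact zero_le
  · calc ∫⁻ z in (ball 0 1)ᶜ, ‖jumpIntegrand f x i z‖ₑ ∂(c.jump x i)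
        ≤ ∫⁻ _ in (ball (0 : Rd d) 1)ᶜ, ENNReal.ofReal (2 * C₀) ∂(c.jump x i) := by
          refine setLIntegral_mono' measurableSet_ball.compl fun z hz => ?_
          rw [Real.enorm_eq_ofReal_abs]
          refine ENNReal.ofReal_le_ofReal ?_
          have : ¬ ‖z‖ < 1 := by simpa using hz
          have h1 := hC₀ x
          have h2 := hC₀ (x + z)
          rw [Real.norm_eq_abs] at h1 h2
          simp only [jumpIntegrand, this, if_false, sub_zero]
          exact (abs_sub _ _).trans (by linarith)
      _ ≤ _ := by
          rw [setLIntegral_const]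
          gcongr
          exact hbig x i

lemma Admissible.integrable_jumpIntegrand (hc : c.Admissible) {i : Fin m}
    (hf : ContDiff ℝ 2 fun y => f y i) (hs : HasCompactSupport fun y => f y i) (x : Rd d) :
    Integrable (jumpIntegrand f x i) (c.jump x i) := by
  obtain ⟨C, hC, h⟩ := hc.exists_lintegral_jumpIntegrand_le hf hs
  exact ⟨(measurable_jumpIntegrand hf x).aestronglyMeasurable, (h x).trans_lt hC⟩

lemma continuous_iteratedFDeriv_two_apply {g : Rd d → ℝ} (hg : ContDiff ℝ 2 g)
    (v : Fin 2 → Rd d) : Continuous fun x => iteratedFDeriv ℝ 2 g x v :=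
  (ContinuousMultilinearMap.apply ℝ (fun _ : Fin 2 => Rd d) ℝ v).continuous.comp
    (hg.continuous_iteratedFDeriv le_rfl)

lemma Admissible.continuous_a (hc : c.Admissible) (i : Fin m) : Continuous fun x => c.a x i :=
  (hc.sig_cont i).matrix_mul (hc.sig_cont i).matrix_transpose

/-- The local part of the generator is continuous. -/
lemma Admissible.continuous_local_part (hc : c.Admissible) {i : Fin m}
    (hf : ContDiff ℝ 2 fun y => f y i) :
    Continuous fun x => (1 / 2) * ∑ k, ∑ l, c.a x i k l *
      iteratedFDeriv ℝ 2 (fun y => f y i) x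
        ![EuclideanSpace.single k (1 : ℝ), EuclideanSpace.single l (1 : ℝ)]
      + ∑ k, c.b x i k * fderiv ℝ (fun y => f y i) x (EuclideanSpace.single k (1 : ℝ)) := by
  refine (continuous_const.mul ?_).add ?_
  · refine continuous_finsetSum _ fun k _ => continuous_finsetSum _ fun l _ => ?_
    exact ((hc.continuous_a i).matrix_elem k l).mul (continuous_iteratedFDeriv_two_apply hf _)
  · refine continuous_finsetSum _ fun k _ => ?_
    exact ((EuclideanSpace.proj k).continuous.comp (hc.b_cont i)).mul
      ((hf.continuous_fderiv (by norm_num)).clm_apply continuous_const)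

lemma Admissible.measurable_gen (hc : c.Admissible) (hf : ∀ i, ContDiff ℝ 2 fun y => f y i)
    (i : Fin m) : Measurable fun x => c.gen f x i := by
  unfold gen
  refine ((hc.continuous_local_part (hf i)).measurable.add ?_).add ?_
  · have hp : ∀ x, ∫ z, jumpIntegrand f x i z ∂(c.jump x i) =
        ∫ z, (ENNReal.ofReal (c.pit x i z)).toReal • jumpIntegrand f x i z := fun x => by
      rw [jump, integral_withDensity_eq_integral_toReal_smul]
      · exact ((hc.pit_meas i).comp measurable_prodMk_left).ennreal_ofReal
      · simp
    simp_rw [hp]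
    have hm : Measurable fun p : Rd d × Rd d =>
        (ENNReal.ofReal (c.pit p.1 i p.2)).toReal • jumpIntegrand f p.1 i p.2 :=
      (hc.pit_meas i).ennreal_ofReal.ennreal_toReal.smul (measurable_jumpIntegrand_uncurry (hf i))
    exact hm.stronglyMeasurable.integral_prod_right'.measurable
  · exact Finset.measurable_sum _ fun j _ => (hc.q_meas i j).mul (hf j).continuous.measurable

lemma Admissible.exists_gen_bound (hc : c.Admissible) (hf : ∀ i, ContDiff ℝ 2 fun y => f y i)
    (hs : ∀ i, HasCompactSupport fun y => f y i) : ∃ C : ℝ, ∀ x i, |c.gen f x i| ≤ C := by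
  suffices H : ∀ i, ∃ C : ℝ, ∀ x, |c.gen f x i| ≤ C by
    choose C hC using H
    obtain ⟨K, hK⟩ := (Set.finite_range C).bddAbove
    exact ⟨K, fun x i => (hC i x).trans (hK ⟨i, rfl⟩)⟩
  intro i
  obtain ⟨C₁, hC₁⟩ : ∃ C : ℝ, ∀ x, ‖(1 / 2) * ∑ k, ∑ l, c.a x i k l *
      iteratedFDeriv ℝ 2 (fun y => f y i) x
        ![EuclideanSpace.single k (1 : ℝ), EuclideanSpace.single l (1 : ℝ)]
      + ∑ k, c.b x i k * fderiv ℝ (fun y => f y i) x (EuclideanSpace.single k (1 : ℝ))‖ ≤ C := by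
    refine HasCompactSupport.exists_bound_of_continuous
      (HasCompactSupport.intro (hs i) fun x hx => ?_) (hc.continuous_local_part (hf i))
    have e3 : fderiv ℝ (fun y => f y i) x = 0 :=
      image_eq_zero_of_notMem_tsupport fun h => hx (tsupport_fderiv_subset ℝ h)
    have e4 : iteratedFDeriv ℝ 2 (fun y => f y i) x = 0 :=
      image_eq_zero_of_notMem_tsupport fun h => hx (tsupport_iteratedFDeriv_subset 2 h)
    simp [e3, e4]
  obtain ⟨C₂, hC₂, hj⟩ := hc.exists_lintegral_jumpIntegrand_le (hf i) (hs i)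
  choose Cq hCq using hc.q_bdd
  choose Cf hCf using fun j => (hs j).exists_bound_of_continuous (hf j).continuous
  refine ⟨C₁ + C₂.toReal + ∑ j, Cq i j * Cf j, fun x => ?_⟩
  refine (abs_add_le _ _).trans (add_le_add ((abs_add_le _ _).trans (add_le_add (hC₁ x) ?_)) ?_)
  · refine (norm_integral_le_lintegral_norm (jumpIntegrand f x i)).trans (ENNReal.toReal_mono hC₂.ne ?_)
    simpa only [ofReal_norm] using hj x
  · refine (Finset.abs_sum_le_sum_abs _ _).trans (Finset.sum_le_sum fun j _ => ?_)
    rw [abs_mul]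
    exact mul_le_mul (hCq i j x) (hCf j x) (abs_nonneg _) ((abs_nonneg _).trans (hCq i j x))

end SwitchingCoeff

lemma isCb2_of_hasCompactSupport {d m : ℕ} {f : Rd d → Fin m → ℝ}
    (hf : ∀ i, ContDiff ℝ 2 fun y => f y i) (hs : ∀ i, HasCompactSupport fun y => f y i) :
    IsCb2 f := by
  intro i
  obtain ⟨C₀, h₀⟩ := (hs i).exists_bound_of_continuous (hf i).continuous
  obtain ⟨C₁, h₁⟩ := ((hs i).fderiv ℝ).exists_bound_of_continuous
    ((hf i).continuous_fderiv (by norm_num))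
  obtain ⟨C₂, h₂⟩ := ((hs i).iteratedFDeriv (𝕜 := ℝ) 2).exists_bound_of_continuous
    ((hf i).continuous_iteratedFDeriv le_rfl)
  exact ⟨hf i, max C₀ (max C₁ C₂), fun x => ⟨(h₀ x).trans (le_max_left _ _),
    (h₁ x).trans ((le_max_left _ _).trans (le_max_right _ _)),
    (h₂ x).trans ((le_max_right _ _).trans (le_max_right _ _))⟩⟩

namespace SwitchingCoeff

variable {d m : ℕ} {c : SwitchingCoeff d m} {D : Set (Rd d)} {V : Rd d → Fin m → ℝ}

/-- Cutting off a Lyapunov function far away yields a compactly supported test function on which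
the generator is still at most `-1` on a large ball outside `D`. -/
lemma IsLyapC1.exists_truncation (hV : c.IsLyapC1 D V) (hc : c.Admissible) (R : ℝ) (hR : 0 ≤ R) :
    ∃ f : Rd d → Fin m → ℝ, (∀ i, ContDiff ℝ 2 fun y => f y i) ∧
      (∀ i, HasCompactSupport fun y => f y i) ∧ (∀ x i, 0 ≤ f x i) ∧ (∀ x i, f x i ≤ V x i) ∧
      ∀ x ∉ D, x ∈ closedBall (0 : Rd d) R → ∀ i, c.gen f x i ≤ -1 := by
  let φ : ContDiffBump (0 : Rd d) := ⟨R + 1, R + 2, by linarith, by linarith⟩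
  have hsm : ∀ i, ContDiff ℝ 2 fun y => φ y * V y i := fun i => φ.contDiff.mul (hV.contDiff i)
  have hcs : ∀ i, HasCompactSupport fun y => φ y * V y i := fun i => φ.hasCompactSupport.mul_right
  have hle : ∀ x i, φ x * V x i ≤ V x i := fun x i =>
    mul_le_of_le_one_left (hV.nonneg x i) φ.le_one
  refine ⟨fun x i => φ x * V x i, hsm, hcs,
    fun x i => mul_nonneg φ.nonneg (hV.nonneg x i), hle, fun x hxD hxR i => ?_⟩
  refine le_trans ?_ (hV.gen_le x hxD i)
  have hx1 : x ∈ ball (0 : Rd d) (R + 1) := by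
    rw [mem_closedBall] at hxR
    rw [mem_ball]
    linarith
  have hev : ∀ j, (fun y => φ y * V y j) =ᶠ[𝓝 x] fun y => V y j := fun j => by
    filter_upwards [isOpen_ball.mem_nhds hx1] with y hy
    rw [φ.one_of_mem_closedBall (ball_subset_closedBall hy), one_mul]
  have hd := (hev i).fderiv_eq (𝕜 := ℝ)
  have hdd := ((hev i).iteratedFDeriv ℝ 2).eq_of_nhds
  have hval : ∀ j, φ x * V x j = V x j := fun j => (hev j).eq_of_nhds
  have hInt : ∫ z, jumpIntegrand (fun x i => φ x * V x i) x i z ∂(c.jump x i) ≤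
      ∫ z, jumpIntegrand V x i z ∂(c.jump x i) := by
    refine integral_mono (hc.integrable_jumpIntegrand (hsm i) (hcs i) x)
      (hV.integrable x hxD i) fun z => ?_
    simp only [jumpIntegrand, hd, hval]
    have := hle (x + z) i
    gcongr
  unfold gen
  simp only [hd, hdd, hval]
  gcongr

end SwitchingCoeff

/-! ### Càdlàg paths and hitting times -/

/-- A right-continuous function on `[0, ∞)` is Borel measurable. -/
lemma measurable_of_continuousWithinAt_Ici {E : Type*} [TopologicalSpace E]
    [TopologicalSpace.PseudoMetrizableSpace E] [MeasurableSpace E] [BorelSpace E] {g : ℝ≥0 → E}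
    (hg : ∀ t, ContinuousWithinAt g (Ici t) t) : Measurable g := by
  let p : ℕ → ℝ≥0 → ℝ≥0 := fun n u => (⌊((n : ℝ≥0) + 1) * u⌋₊ + 1 : ℕ) / ((n : ℝ≥0) + 1)
  have hn : ∀ n : ℕ, (0 : ℝ≥0) < (n : ℝ≥0) + 1 := fun n => by positivity
  have hlo : ∀ n u, u ≤ p n u := fun n u => by
    rw [le_div_iff₀ (hn n), mul_comm]
    exact_mod_cast (Nat.lt_floor_add_one (((n : ℝ≥0) + 1) * u)).le
  have hhi : ∀ n u, p n u ≤ u + 1 / ((n : ℝ≥0) + 1) := fun n u => by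
    rw [div_le_iff₀ (hn n), add_mul u, div_mul_cancel₀ _ (hn n).ne', mul_comm u]
    push_cast
    gcongr
    exact Nat.floor_le zero_le
  refine measurable_of_tendsto_metrizable (f := fun n u => g (p n u)) (fun n => ?_) ?_
  · exact (measurable_from_nat (f := fun k : ℕ => g ((k + 1 : ℕ) / ((n : ℝ≥0) + 1)))).comp
      (Nat.measurable_floor.comp (measurable_const.mul measurable_id))
  · rw [tendsto_pi_nhds]
    intro u
    refine (hg u).tendsto.comp (tendsto_nhdsWithin_iff.2 ⟨?_, Eventually.of_forall fun n => hlo n u⟩)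
    refine tendsto_of_tendsto_of_tendsto_of_le_of_le tendsto_const_nhds ?_
      (fun n => hlo n u) (fun n => hhi n u)
    simpa using (tendsto_const_nhds (x := u)).add
      (tendsto_one_div_add_atTop_nhds_zero_nat (𝕜 := ℝ≥0))

/-- A path with right limits equal to its values and with left limits is bounded on compacts. -/
lemma exists_norm_le_of_cadlag {E : Type*} [SeminormedAddCommGroup E] {g : ℝ≥0 → E}
    (hr : ∀ t, ContinuousWithinAt g (Ici t) t)
    (hl : ∀ t, 0 < t → ∃ L, Tendsto g (𝓝[<] t) (𝓝 L)) (T : ℝ≥0) :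
    ∃ C : ℝ, ∀ t ≤ T, ‖g t‖ ≤ C := by
  have key : ∃ C : ℝ, ∀ t ∈ Icc 0 T, ‖g t‖ ≤ C := by
    refine isCompact_Icc.induction_on (p := fun s => ∃ C : ℝ, ∀ t ∈ s, ‖g t‖ ≤ C)
      ⟨0, by simp⟩ (fun s t hst ⟨C, hC⟩ => ⟨C, fun u hu => hC u (hst hu)⟩)
      (fun s t ⟨C, hC⟩ ⟨C', hC'⟩ => ⟨max C C', fun u hu => hu.elim
        (fun h => (hC u h).trans (le_max_left _ _))
        (fun h => (hC' u h).trans (le_max_right _ _))⟩) fun t _ => ?_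
    have hR : ∃ C : ℝ, ∀ᶠ u in 𝓝[≥] t, ‖g u‖ ≤ C :=
      ⟨‖g t‖ + 1, (((hr t).tendsto.norm).eventually_lt_const (lt_add_one _)).mono fun _ h => h.le⟩
    have hL : ∃ C : ℝ, ∀ᶠ u in 𝓝[<] t, ‖g u‖ ≤ C := by
      rcases eq_zero_or_pos t with rfl | ht
      · exact ⟨0, by simp⟩
      · obtain ⟨L, hL⟩ := hl t ht
        exact ⟨‖L‖ + 1, (hL.norm.eventually_lt_const (lt_add_one _)).mono fun _ h => h.le⟩
    obtain ⟨C, hC⟩ := hR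
    obtain ⟨C', hC'⟩ := hL
    refine ⟨{u | ‖g u‖ ≤ max C C'}, mem_nhdsWithin_of_mem_nhds ?_, max C C', fun _ h => h⟩
    rw [← nhdsLT_sup_nhdsGE]
    exact mem_sup.2 ⟨hC'.mono fun u h => h.trans (le_max_right _ _),
      hC.mono fun u h => h.trans (le_max_left _ _)⟩
  obtain ⟨C, hC⟩ := key
  exact ⟨C, fun t ht => hC t ⟨zero_le, ht⟩⟩

section Hit

variable {Ω α : Type*} {Z : ℝ≥0 → Ω → α} {U : Set α} {ω : Ω}

lemma hit_le {t : ℝ≥0} (h : Z t ω ∈ U) : hit Z U ω ≤ t := iInf₂_le t h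

lemma notMem_of_lt_hit {t : ℝ≥0} (h : (t : ℝ≥0∞) < hit Z U ω) : Z t ω ∉ U :=
  fun h' => (hit_le h').not_gt h

lemma exists_mem_of_hit_lt {a : ℝ≥0∞} (h : hit Z U ω < a) :
    ∃ t : ℝ≥0, Z t ω ∈ U ∧ (t : ℝ≥0∞) < a := by
  simpa only [hit, iInf_lt_iff, exists_prop] using h

lemma hit_anti {U' : Set α} (h : U ⊆ U') : hit Z U' ω ≤ hit Z U ω :=
  le_iInf₂ fun _ ht => hit_le (h ht)

/-- The index of the first of the times `j t / (K + 1)`, `j ≤ K + 1`, at which `Z` is in `U`. -/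
noncomputable def gridHitIndex (Z : ℝ≥0 → Ω → α) (U : Set α) (t : ℝ≥0) (K : ℕ) : Ω → ℕ :=
  hittingBtwn (fun (j : ℕ) ω => Z (j * (t / (K + 1))) ω) U 0 (K + 1)

/-- The first of the times `j t / (K + 1)`, `j ≤ K + 1`, at which `Z` is in `U`, and `t` if there
is none. -/
noncomputable def gridHit (Z : ℝ≥0 → Ω → α) (U : Set α) (t : ℝ≥0) (K : ℕ) (ω : Ω) : ℝ≥0 :=
  gridHitIndex Z U t K ω * (t / (K + 1))

lemma gridHitIndex_le (t : ℝ≥0) (K : ℕ) (ω : Ω) : gridHitIndex Z U t K ω ≤ K + 1 :=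
  hittingBtwn_le ω

lemma grid_end (t : ℝ≥0) (K : ℕ) : ((K + 1 : ℕ) : ℝ≥0) * (t / (K + 1)) = t := by
  push_cast
  exact mul_div_cancel₀ t (by positivity)

lemma gridHit_le (t : ℝ≥0) (K : ℕ) (ω : Ω) : gridHit Z U t K ω ≤ t := by
  refine le_of_le_of_eq ?_ (grid_end t K)
  unfold gridHit
  gcongr
  exact gridHitIndex_le t K ω

lemma min_hit_le_gridHit (t : ℝ≥0) (K : ℕ) (ω : Ω) :
    min (t : ℝ≥0∞) (hit Z U ω) ≤ gridHit Z U t K ω := by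
  rcases (gridHitIndex_le (Z := Z) (U := U) t K ω).lt_or_eq with h | h
  · exact (min_le_right _ _).trans (hit_le (hittingBtwn_mem_set_of_hittingBtwn_lt h))
  · rw [gridHit, h, grid_end]
    exact min_le_left _ _

lemma tendsto_gridHit [TopologicalSpace α] (hU : IsOpen U)
    (hZ : ∀ t, ContinuousWithinAt (fun s => Z s ω) (Ici t) t) (t : ℝ≥0) :
    Tendsto (fun K => (gridHit Z U t K ω : ℝ≥0∞)) atTop (𝓝 (min (t : ℝ≥0∞) (hit Z U ω))) := by
  refine tendsto_order.2 ⟨fun a ha => Eventually.of_forall fun K =>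
    ha.trans_le (min_hit_le_gridHit t K ω), fun a ha => ?_⟩
  rcases le_or_gt (t : ℝ≥0∞) (hit Z U ω) with h | h
  · rw [min_eq_left h] at ha
    exact Eventually.of_forall fun K => lt_of_le_of_lt (by exact_mod_cast gridHit_le t K ω) ha
  rw [min_eq_right h.le] at ha
  obtain ⟨s, hsU, hs⟩ := exists_mem_of_hit_lt (lt_min ha h)
  obtain ⟨hsa, hst⟩ := lt_min_iff.1 hs
  have hst : s < t := by exact_mod_cast hst
  obtain ⟨b₀, hb₀, hsub⟩ := (mem_nhdsGE_iff_exists_Ico_subset' hst).1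
    ((hZ s).tendsto.eventually (hU.mem_nhds hsU))
  obtain ⟨a', hsa', ha'⟩ := ENNReal.lt_iff_exists_nnreal_btwn.1 hsa
  have hsa' : s < a' := by exact_mod_cast hsa'
  let b := min b₀ (min a' t)
  have hsb : s < b := lt_min hb₀ (lt_min hsa' hst)
  have ht : 0 < t := zero_le.trans_lt hst
  have hmesh : Tendsto (fun K : ℕ => s + t / ((K : ℝ≥0) + 1)) atTop (𝓝 s) := by
    simpa [div_eq_mul_inv] using (tendsto_const_nhds (x := s)).add
      ((tendsto_one_div_add_atTop_nhds_zero_nat (𝕜 := ℝ≥0)).const_mul t)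
  filter_upwards [hmesh.eventually_lt_const hsb] with K hK
  set h := t / ((K : ℝ≥0) + 1) with hh
  have hpos : 0 < h := div_pos ht (by positivity)
  set j := ⌈s / h⌉₊
  have hj1 : s ≤ j * h := by
    rw [← div_le_iff₀ hpos]
    exact Nat.le_ceil _
  have hj2 : j * h < b := by
    refine lt_of_lt_of_le ?_ hK.le
    have := Nat.ceil_lt_add_one (a := s / h) zero_le
    calc (j : ℝ≥0) * h < (s / h + 1) * h := by gcongr
      _ = s + h := by rw [add_mul, div_mul_cancel₀ _ hpos.ne', one_mul]
  have hjK : j ≤ K + 1 := by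
    have h1 : (j : ℝ≥0) * h < ((K + 1 : ℕ) : ℝ≥0) * h := by
      rw [hh, grid_end]
      exact hj2.trans_le ((min_le_right _ _).trans (min_le_right _ _))
    exact_mod_cast (lt_of_mul_lt_mul_right h1 zero_le).le
  have hmem : Z (j * h) ω ∈ U := hsub ⟨hj1, hj2.trans_le (min_le_left _ _)⟩
  have hle : gridHit Z U t K ω ≤ j * h := by
    unfold gridHit
    gcongr
    exact hittingBtwn_le_of_mem (u := fun (j : ℕ) ω => Z (j * (t / (K + 1))) ω) (Nat.zero_le j)
      hjK hmem
  refine lt_trans ?_ ha'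
  exact_mod_cast hle.trans_lt (hj2.trans_le ((min_le_right _ _).trans (min_le_left _ _)))

end Hit

/-! ### Dynkin's inequality up to a hitting time -/

namespace SwitchingJumpDiffusion

variable {d m : ℕ} {c : SwitchingCoeff d m} {Ω : Type*} [mΩ : MeasurableSpace Ω]
  (s : SwitchingJumpDiffusion c Ω)

/-- The filtration sampled at the times `j h`. -/
def gridFiltration (h : ℝ≥0) : Filtration ℕ mΩ where
  seq j := s.ℱ (j * h)
  mono' _ _ hij := s.ℱ.mono (by gcongr)
  le' _ := s.ℱ.le _

lemma X_continuousWithinAt (ω : Ω) (t : ℝ≥0) :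
    ContinuousWithinAt (fun u => s.X u ω) (Ici t) t :=
  (s.cadlag_right ω t).fst

lemma X_measurable (t : ℝ≥0) : Measurable (s.X t) := (s.X_adapted t).mono (s.ℱ.le t) le_rfl

lemma Λ_measurable (t : ℝ≥0) : Measurable (s.Λ t) := (s.Λ_adapted t).mono (s.ℱ.le t) le_rfl

lemma isStoppingTime_gridHitIndex {U : Set (Rd d)} (hU : MeasurableSet U) (t : ℝ≥0) (K : ℕ) :
    IsStoppingTime (s.gridFiltration (t / (K + 1)))
      fun ω => ((gridHitIndex s.X U t K ω : ℕ) : WithTop ℕ) :=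
  Adapted.isStoppingTime_hittingBtwn (f := s.gridFiltration (t / (K + 1)))
    (fun j => s.X_adapted (j * (t / (K + 1)))) hU

lemma measurable_gridHit {U : Set (Rd d)} (hU : MeasurableSet U) (t : ℝ≥0) (K : ℕ) :
    Measurable (gridHit s.X U t K) := by
  have h : Measurable (gridHitIndex s.X U t K) := by
    refine measurable_of_Iic fun n => ?_
    have h1 := (s.gridFiltration (t / (K + 1))).le n _ (s.isStoppingTime_gridHitIndex hU t K n)
    convert h1 using 1
    ext ω
    simp
  exact (measurable_from_nat (f := fun j : ℕ => (j : ℝ≥0) * (t / (K + 1)))).comp h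

lemma measurable_min_hit {U : Set (Rd d)} (hU : IsOpen U) (t : ℝ≥0) :
    Measurable fun ω => min (t : ℝ≥0∞) (hit s.X U ω) :=
  measurable_of_tendsto_metrizable
    (fun K => (s.measurable_gridHit hU.measurableSet t K).coe_nnreal_ennreal)
    (tendsto_pi_nhds.2 fun ω => tendsto_gridHit hU (s.X_continuousWithinAt ω) t)

/-- Along each path, a Borel function of the state is Borel in time. -/
lemma measurable_path {F : Rd d → Fin m → ℝ} (hF : ∀ i, Measurable fun x => F x i) (ω : Ω) :
    Measurable fun u : ℝ => F (s.X u.toNNReal ω) (s.Λ u.toNNReal ω) := by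
  have h1 : Measurable fun p : Rd d × Fin m => F p.1 p.2 :=
    measurable_from_prod_countable_left hF
  exact h1.comp ((measurable_of_continuousWithinAt_Ici (s.cadlag_right ω)).comp
    measurable_real_toNNReal)

/-- Pathwise bound of a time integral up to `T` by splitting at the capped hitting time `θ`. -/
lemma setIntegral_path_le {F : Rd d → Fin m → ℝ} (hF : ∀ i, Measurable fun x => F x i) {C : ℝ}
    (hC : ∀ x i, |F x i| ≤ C) {U : Set (Rd d)} (hU : ∀ x ∉ U, ∀ i, F x i ≤ -1) (ω : Ω)
    {θ T : ℝ≥0} (hθ : (θ : ℝ≥0∞) ≤ hit s.X U ω) (hT : θ ≤ T) :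
    ∫ u in Ioc (0 : ℝ) (T : ℝ), F (s.X u.toNNReal ω) (s.Λ u.toNNReal ω) ≤
      C * T - (1 + C) * θ := by
  let g : ℝ → ℝ := fun u => F (s.X u.toNNReal ω) (s.Λ u.toNNReal ω)
  change ∫ u in Ioc (0 : ℝ) (T : ℝ), g u ≤ _
  have hInt : ∀ p q : ℝ, IntervalIntegrable g volume p q := fun p q =>
    (intervalIntegrable_const (c := C)).mono_fun
      (s.measurable_path hF ω).aestronglyMeasurable
      (Eventually.of_forall fun u => (hC _ _).trans (le_abs_self C))
  have hT' : (θ : ℝ) ≤ T := by exact_mod_cast hT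
  rw [← intervalIntegral.integral_of_le T.coe_nonneg,
    ← intervalIntegral.integral_add_adjacent_intervals (hInt 0 θ) (hInt θ T)]
  have h1 : ∫ u in (0 : ℝ)..θ, g u ≤ ∫ _ in (0 : ℝ)..θ, (-1 : ℝ) := by
    refine intervalIntegral.integral_mono_on_of_le_Ioo θ.coe_nonneg (hInt _ _) intervalIntegrable_const
      fun u hu => hU _ (notMem_of_lt_hit (lt_of_lt_of_le ?_ hθ)) _
    exact_mod_cast (Real.toNNReal_lt_iff_lt_coe hu.1.le).2 hu.2
  have h2 : ∫ u in (θ : ℝ)..T, g u ≤ ∫ _ in (θ : ℝ)..T, C :=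
    intervalIntegral.integral_mono_on hT' (hInt _ _) intervalIntegrable_const
      fun u _ => (le_abs_self _).trans (hC _ _)
  rw [intervalIntegral.integral_const, smul_eq_mul] at h1 h2
  linarith

/-- If `f ≥ 0` is compactly supported and `Gf ≤ -1` off the open set `U`, the entrance time of `U`
capped at `t` has expectation at most `f(x,i)`. -/
lemma lintegral_min_hit_le (hc : c.Admissible) {f : Rd d → Fin m → ℝ}
    (hf : ∀ i, ContDiff ℝ 2 fun y => f y i) (hs : ∀ i, HasCompactSupport fun y => f y i)
    (hf0 : ∀ x i, 0 ≤ f x i) {U : Set (Rd d)} (hUo : IsOpen U)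
    (hU : ∀ x ∉ U, ∀ i, c.gen f x i ≤ -1) (t : ℝ≥0) (x : Rd d) (i : Fin m) :
    ∫⁻ ω, min (t : ℝ≥0∞) (hit s.X U ω) ∂(s.P x i) ≤ ENNReal.ofReal (f x i) := by
  have := s.prob x i
  obtain ⟨C, hC⟩ := hc.exists_gen_bound hf hs
  let θ : Ω → ℝ := fun ω => (min (t : ℝ≥0∞) (hit s.X U ω)).toReal
  have hfin : ∀ ω, min (t : ℝ≥0∞) (hit s.X U ω) ≠ ⊤ := fun ω =>
    ne_top_of_le_ne_top ENNReal.coe_ne_top (min_le_left _ _)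
  have hθm : Measurable θ := (s.measurable_min_hit hUo t).ennreal_toReal
  have hθt : ∀ ω, θ ω ≤ t := fun ω =>
    ENNReal.toReal_mono ENNReal.coe_ne_top (min_le_left _ _)
  have hθint : Integrable θ (s.P x i) := Integrable.of_bound hθm.aestronglyMeasurable t
    (Eventually.of_forall fun ω => by
      rw [Real.norm_of_nonneg ENNReal.toReal_nonneg]
      exact hθt ω)
  have hTm : ∀ K, Measurable fun ω => (gridHit s.X U t K ω : ℝ) := fun K =>
    (s.measurable_gridHit hUo.measurableSet t K).coe_nnreal_real
  have hTb : ∀ K ω, ‖(gridHit s.X U t K ω : ℝ)‖ ≤ t := fun K ω => by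
    rw [Real.norm_of_nonneg (NNReal.coe_nonneg _)]
    exact_mod_cast gridHit_le t K ω
  have hTint : ∀ K, Integrable (fun ω => (gridHit s.X U t K ω : ℝ)) (s.P x i) := fun K =>
    Integrable.of_bound (hTm K).aestronglyMeasurable t (Eventually.of_forall (hTb K))
  have hlim : Tendsto (fun K => ∫ ω, (gridHit s.X U t K ω : ℝ) ∂(s.P x i)) atTop
      (𝓝 (∫ ω, θ ω ∂(s.P x i))) := by
    refine tendsto_integral_of_dominated_convergence (fun _ => (t : ℝ))
      (fun K => (hTm K).aestronglyMeasurable) (integrable_const _)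
      (fun K => Eventually.of_forall (hTb K)) (Eventually.of_forall fun ω => ?_)
    exact (ENNReal.tendsto_toReal (hfin ω)).comp
      (tendsto_gridHit hUo (s.X_continuousWithinAt ω) t)
  have hstep : ∀ K, 0 ≤ f x i + C * ∫ ω, (gridHit s.X U t K ω : ℝ) ∂(s.P x i) -
      (1 + C) * ∫ ω, θ ω ∂(s.P x i) := fun K => by
    set h : ℝ≥0 := t / (K + 1)
    let M : ℝ≥0 → Ω → ℝ := fun t ω => f (s.X t ω) (s.Λ t ω) - f x i -
      ∫ u in Set.Ioc (0 : ℝ) (t : ℝ), c.gen f (s.X u.toNNReal ω) (s.Λ u.toNNReal ω)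
    have hM : Martingale M s.ℱ (s.P x i) :=
      s.martingale_problem f (isCb2_of_hasCompactSupport hf hs) x i
    have hN : Martingale (fun (j : ℕ) => M (j * h)) (s.gridFiltration h) (s.P x i) :=
      ⟨fun j => hM.1 (j * h), fun j k hjk => hM.2 (j * h) (k * h) (by gcongr)⟩
    have hsub := hN.neg.submartingale
    have hτ := s.isStoppingTime_gridHitIndex hUo.measurableSet t K
    have hτle : ∀ ω, ((gridHitIndex s.X U t K ω : ℕ) : WithTop ℕ) ≤ ((K + 1 : ℕ) : WithTop ℕ) :=
      fun ω => by exact_mod_cast gridHitIndex_le t K ω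
    have hmono := hsub.expected_stoppedValue_mono (isStoppingTime_const _ 0) hτ
      (fun ω => WithTop.coe_le_coe.2 (Nat.zero_le _)) hτle
    have hInt := hsub.integrable_stoppedValue hτ hτle
    have hinit : ∀ᵐ ω ∂(s.P x i), M 0 ω = 0 := by
      have hset : MeasurableSet {ω | s.X 0 ω = x ∧ s.Λ 0 ω = i} :=
        (s.X_measurable 0 (measurableSet_singleton x)).inter
          (s.Λ_measurable 0 (measurableSet_singleton i))
      filter_upwards [(prob_compl_eq_zero_iff hset).2 (s.init x i)] with ω hω
      simp [M, hω.1, hω.2]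
    have h0 : ∫ ω, stoppedValue (-fun (j : ℕ) => M (j * h)) (fun _ => ((0 : ℕ) : WithTop ℕ)) ω
        ∂(s.P x i) = 0 := by
      refine integral_eq_zero_of_ae (hinit.mono fun ω hω => ?_)
      simp [stoppedValue, hω]
    have hle : ∀ ω, stoppedValue (-fun (j : ℕ) => M (j * h))
        (fun ω => ((gridHitIndex s.X U t K ω : ℕ) : WithTop ℕ)) ω ≤
        f x i + C * (gridHit s.X U t K ω : ℝ) - (1 + C) * θ ω := fun ω => by
      have hp := s.setIntegral_path_le (fun i => hc.measurable_gen hf i) hC hU ω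
        (θ := (min (t : ℝ≥0∞) (hit s.X U ω)).toNNReal) (T := gridHit s.X U t K ω)
        (by rw [ENNReal.coe_toNNReal (hfin ω)]; exact min_le_right _ _)
        (by
          rw [← ENNReal.coe_le_coe, ENNReal.coe_toNNReal (hfin ω)]
          exact min_hit_le_gridHit t K ω)
      have hv : stoppedValue (-fun (j : ℕ) => M (j * h))
          (fun ω => ((gridHitIndex s.X U t K ω : ℕ) : WithTop ℕ)) ω =
          -M (gridHit s.X U t K ω) ω := rfl
      rw [hv]
      have := hf0 (s.X (gridHit s.X U t K ω) ω) (s.Λ (gridHit s.X U t K ω) ω)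
      change _ ≤ _ - (1 + C) * θ ω at hp
      simp only [M]
      linarith
    have hle' := integral_mono hInt
      (((integrable_const (f x i)).add ((hTint K).const_mul C)).sub (hθint.const_mul (1 + C))) hle
    have hev : ∫ ω, (f x i + C * (gridHit s.X U t K ω : ℝ) - (1 + C) * θ ω) ∂(s.P x i) =
        f x i + C * ∫ ω, (gridHit s.X U t K ω : ℝ) ∂(s.P x i) -
          (1 + C) * ∫ ω, θ ω ∂(s.P x i) := by
      have hadd : Integrable (fun ω => f x i + C * (gridHit s.X U t K ω : ℝ)) (s.P x i) :=
        (integrable_const _).add ((hTint K).const_mul C)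
      rw [integral_sub hadd (hθint.const_mul _), integral_add (integrable_const _) ((hTint K).const_mul C), integral_const_mul,
        integral_const_mul]
      simp
    rw [← hev]
    exact h0.symm.le.trans (hmono.trans hle')
  have hE : ∫ ω, θ ω ∂(s.P x i) ≤ f x i := by
    have := ge_of_tendsto' ((((hlim.const_mul C).const_add (f x i)).sub_const
      ((1 + C) * ∫ ω, θ ω ∂(s.P x i)))) hstep
    linarith
  calc ∫⁻ ω, min (t : ℝ≥0∞) (hit s.X U ω) ∂(s.P x i)
      = ∫⁻ ω, ENNReal.ofReal (θ ω) ∂(s.P x i) :=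
        lintegral_congr fun ω => (ENNReal.ofReal_toReal (hfin ω)).symm
    _ = ENNReal.ofReal (∫ ω, θ ω ∂(s.P x i)) :=
        (ofReal_integral_eq_lintegral_ofReal hθint
          (Eventually.of_forall fun ω => ENNReal.toReal_nonneg)).symm
    _ ≤ ENNReal.ofReal (f x i) := ENNReal.ofReal_le_ofReal hE

lemma sigmaZ_prod_univ (D : Set (Rd d)) :
    s.sigmaZ (D ×ˢ (Set.univ : Set (Fin m))) = s.sigmaX D := by
  funext ω
  simp [sigmaZ, sigmaX, hit]

/-- Paths do not explode: the entrance time of `D` is the increasing limit of the capped entrance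
times of `D ∪ B̄(0,n)ᶜ`. -/
lemma sigmaX_eq_iSup (D : Set (Rd d)) (ω : Ω) : s.sigmaX D ω =
    ⨆ n : ℕ, min ((n : ℝ≥0) : ℝ≥0∞) (hit s.X (D ∪ (closedBall (0 : Rd d) n)ᶜ) ω) := by
  refine le_antisymm (le_of_forall_lt fun a ha => ?_)
    (iSup_le fun n => (min_le_right _ _).trans (hit_anti subset_union_left))
  obtain ⟨T, haT, hT⟩ := ENNReal.lt_iff_exists_nnreal_btwn.1 ha
  obtain ⟨C, hC⟩ := exists_norm_le_of_cadlag (s.X_continuousWithinAt ω)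
    (fun t ht => (s.cadlag_left ω t ht).imp' Prod.fst fun L hL => (continuous_fst.tendsto L).comp hL)
    T
  obtain ⟨n, hn⟩ := exists_nat_ge (max C T)
  refine haT.trans_le (le_iSup_of_le n (le_min ?_ (le_iInf₂ fun u hu => ?_)))
  · exact_mod_cast (le_max_right C (T : ℝ)).trans hn
  · by_contra! hlt
    rcases hu with hu | hu
    · exact notMem_of_lt_hit (hlt.trans hT) hu
    · refine hu (mem_closedBall_zero_iff.2 ((hC u ?_).trans ((le_max_left _ _).trans hn)))
      exact_mod_cast hlt.le

lemma measurable_sigmaX {D : Set (Rd d)} (hD : IsOpen D) : Measurable (s.sigmaX D) := by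
  rw [funext (s.sigmaX_eq_iSup D)]
  exact Measurable.iSup fun n =>
    s.measurable_min_hit (hD.union isClosed_closedBall.isOpen_compl) n

/-- A Lyapunov function dominates the expected entrance time. -/
lemma lintegral_sigmaX_le (hc : c.Admissible) {D : Set (Rd d)} (hD : IsOpen D)
    {V : Rd d → Fin m → ℝ} (hV : c.IsLyapC1 D V) (x : Rd d) (i : Fin m) :
    ∫⁻ ω, s.sigmaX D ω ∂(s.P x i) ≤ ENNReal.ofReal (V x i) := by
  have hopen : ∀ n : ℕ, IsOpen (D ∪ (closedBall (0 : Rd d) n)ᶜ) := fun n =>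
    hD.union isClosed_closedBall.isOpen_compl
  rw [lintegral_congr (s.sigmaX_eq_iSup D), lintegral_iSup
    (fun n => s.measurable_min_hit (hopen n) n)]
  · refine iSup_le fun n => ?_
    obtain ⟨f, hf, hs, hf0, hfV, hgen⟩ := hV.exists_truncation hc n n.cast_nonneg
    refine (s.lintegral_min_hit_le hc hf hs hf0 (hopen n) (fun y hy j => ?_) n x i).trans
      (ENNReal.ofReal_le_ofReal (hfV x i))
    rw [mem_union, not_or, notMem_compl_iff] at hy
    exact hgen y hy.1 hy.2 j
  · intro n k hnk ω
    refine min_le_min (ENNReal.coe_le_coe.2 (Nat.cast_le.2 hnk)) (hit_anti (union_subset_union_right D ?_))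
    exact compl_subset_compl.2 (closedBall_subset_closedBall (by exact_mod_cast hnk))

end SwitchingJumpDiffusion

theorem positive_recurrence_of_C1 {d m : ℕ} (hd : 1 ≤ d) (hm : 1 ≤ m)
    (c : SwitchingCoeff d m) (hc : c.Admissible)
    {Ω : Type*} [MeasurableSpace Ω] (s : SwitchingJumpDiffusion c Ω)
    (D : Set (Rd d)) (hD : BddDomain D)
    (V : Rd d → Fin m → ℝ) (hV : c.IsLyapC1 D V) :
    s.PosRecurrent (D ×ˢ (Set.univ : Set (Fin m))) ∧
      ∀ x i, (x, i) ∉ D ×ˢ (Set.univ : Set (Fin m)) →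
        (∫⁻ ω, s.sigmaX D ω ∂(s.P x i)) ≤ ENNReal.ofReal (V x i) := by
  have key := fun x i => s.lintegral_sigmaX_le hc hD.1 hV x i
  have hlt := fun x i => (key x i).trans_lt ENNReal.ofReal_lt_top
  refine ⟨⟨fun x i _ => ?_, fun x i _ => ?_⟩, fun x i _ => key x i⟩
  · have := s.prob x i
    rw [s.sigmaZ_prod_univ D]
    exact (prob_compl_eq_zero_iff (measurableSet_lt (s.measurable_sigmaX hD.1) measurable_const)).1
      (ae_lt_top (s.measurable_sigmaX hD.1) (hlt x i).ne)
  · rw [s.sigmaZ_prod_univ D]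
    exact hlt x i
end

section
/- Let $d,m\ge 1$ and $\mathcal M=\{1,\dots,m\}$; $B(x,r)$ denotes the open Euclidean ball, and a domain is a nonempty connected open subset of $\mathbb R^d$. For $i,j\in\mathcal M$ let $b(\cdot,i):\mathbb R^d\to\mathbb R^d$ and $\sigma(\cdot,i):\mathbb R^d\to\mathbb R^{d\times d}$ be continuous, $q_{ij}:\mathbb R^d\to\mathbb R$ bounded and Borel with $q_{ij}\ge 0$ for $i\ne j$ and $\sum_{j}q_{ij}=0$, and $\widetilde\pi_i:\mathbb R^d\times\mathbb R^d\to[0,\infty)$ Borel. Put $a=\sigma\sigma^{\mathsf T}$ and $\pi_i(x,dz)=\widetilde\pi_i(x,z)\,dz$, and assume: (A1) $\sum_{k,l}|\sigma_{kl}(x,i)|+\sum_k|b_k(x,i)|\le c(1+|x|)$ for all $x,i$, for some $c>0$. (A2) For every bounded domain $D$ there is $\kappa_0\in(0,1]$ with $\kappa_0|\xi|^2\le \xi^{\mathsf T}a(x,i)\xi\le\kappa_0^{-1}|\xi|^2$ for all $\xi\in\mathbb R^d$, $x\in D$, $i\in\mathcal M$. (A3) $\int(1\wedge|z|^2)\,\pi_i(x,dz)<\infty$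 for all $x,i$; $\sup_{x,i}\pi_i(x,B(0,1)^c)<\infty$; $\int_{B(0,1)}|z|^2\pi_i(x,dz)\le c'(1+|x|^2)$ for all $x,i$, for some $c'>0$; and for every integer $n\ge1$ there is a $\sigma$-finite measure $\Pi_n$ with $\int(1\wedge|z|^2)\,\Pi_n(dz)<\infty$ and $\pi_i(x,\cdot)\le\Pi_n$ for all $x\in B(0,n)$, $i\in\mathcal M$. (A4) There are $\kappa_2,\beta>0$ such that for every $r\in(0,1)$ there is $\alpha_r$ with $1<\alpha_r<\kappa_2r^{-\beta}$ and $\widetilde\pi_i(x,z-x)\le\alpha_r\,\widetilde\pi_i(y,z-y)$ for all $x_0\in\mathbb R^d$, $x,y\in B(x_0,r/2)$, $z\in B(x_0,r)^c$, $i\in\mathcal M$. For $f:\mathbb R^d\times\mathcal M\to\mathbb R$ with each $f(\cdot,i)\in C^2_b(\mathbb R^d)$ ($C^2$, bounded with bounded partial derivatives of orders 1 and 2) let $$\mathcal Gf(x,i)=\tfrac12\sum_{k,l}a_{kl}(x,i)\,\partial_k\partial_lf(x,i)+\sum_kb_k(x,i)\,\partial_kf(x,i)+\int\big[f(x+z,i)-f(x,i)-\nabla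 f(x,i)\cdot z\,\mathbf 1_{\{|z|<1\}}\big]\pi_i(x,dz)+\sum_{j}q_{ij}(x)f(x,j).$$ Let $\Omega$ be the space of right-continuous paths with left limits $[0,\infty)\to\mathbb R^d\times\mathcal M$, $(X(t),\Lambda(t))$ the coordinate process and $(\mathcal F_t)$ the right-continuous filtration that it generates. Let $(\mathbb P_{x,i})$ be a family of probability measures on $\Omega$, measurable in $(x,i)$, under which $(X,\Lambda)$ is a strong Markov process with respect to $(\mathcal F_t)$, and which solves the martingale problem for $(\mathcal G,C_b^2(\mathbb R^d))$: $\mathbb P_{x,i}(X(0)=x,\Lambda(0)=i)=1$, and $$f(X(t),\Lambda(t))-f(X(0),\Lambda(0))-\int_0^t\mathcal Gf(X(s),\Lambda(s))\,ds$$ is a $\mathbb P_{x,i}$-martingale for every $f$ with each $f(\cdot,j)\in C_b^2(\mathbb R^d)$ and $\mathcal Gf$ bounded. For $D\subset\mathbb R^d$ let $\sigma_D=\inf\{t\ge0:X(t)\in D\}$ (with $\inf\emptyset=\infty$). Suppose that $\mathcal G$ is strictly irreducible on every bounded domain $U$, that is, for all $i\ne j$ there is $q^0_{ij}>0$ with $\inf_{x\in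 U}q_{ij}(x)\ge q^0_{ij}$. Let $D\subset\mathbb R^d$ be a bounded domain such that $\mathbb P_{x,i}(\sigma_D<\infty)=1$ for every $(x,i)\in D^c\times\mathcal M$. Then for every bounded domain $E\subset\mathbb R^d$, $\mathbb P_{x,i}(\sigma_E<\infty)=1$ for every $(x,i)\in E^c\times\mathcal M$. -/
open MeasureTheory ProbabilityTheory Set Filter Metric Matrix
open scoped NNReal ENNReal Topology

noncomputable section

/-- The coefficients of a regime-switching jump diffusion on `ℝ^d × {1,…,m}`. -/
structure Coeff (d m : ℕ) where
  /-- drift `b(x,i)` -/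
  b : Rd d → Fin m → Rd d
  /-- diffusion matrix `σ(x,i)` -/
  sig : Rd d → Fin m → Matrix (Fin d) (Fin d) ℝ
  /-- switching rates `q_{ij}(x)` -/
  q : Rd d → Fin m → Fin m → ℝ
  /-- jump density `π̃_i(x,z)` -/
  pit : Rd d → Fin m → Rd d → ℝ

namespace Coeff

variable {d m : ℕ}

/-- `a(x,i) = σ(x,i) σ(x,i)ᵀ`. -/
def a (c : Coeff d m) (x : Rd d) (i : Fin m) : Matrix (Fin d) (Fin d) ℝ :=
  c.sig x i * (c.sig x i)ᵀ

/-- The jump measure `π_i(x, dz) = π̃_i(x,z) dz`. -/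
def π (c : Coeff d m) (x : Rd d) (i : Fin m) : Measure (Rd d) :=
  volume.withDensity fun z => ENNReal.ofReal (c.pit x i z)

/-- The generator
`Gf(x,i) = ½ Σ a_{kl} ∂²f/∂x_k∂x_l + Σ b_k ∂f/∂x_k
  + ∫ [f(x+z,i) − f(x,i) − ∇f(x,i)·z 1_{|z|<1}] π_i(x,dz) + Σ_j q_{ij}(x) f(x,j)`. -/
def G (c : Coeff d m) (f : Rd d → Fin m → ℝ) (x : Rd d) (i : Fin m) : ℝ :=
  (1 / 2) * ∑ k, ∑ l, c.a x i k l *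
      iteratedFDeriv ℝ 2 (fun y => f y i) x
        ![EuclideanSpace.single k (1 : ℝ), EuclideanSpace.single l (1 : ℝ)]
    + ∑ k, c.b x i k * fderiv ℝ (fun y => f y i) x (EuclideanSpace.single k (1 : ℝ))
    + ∫ z, (f (x + z) i - f x i -
        (if ‖z‖ < 1 then fderiv ℝ (fun y => f y i) x z else 0)) ∂(c.π x i)
    + ∑ j, c.q x i j * f x j

/-- The standing assumptions on the coefficients. -/
structure Standing (c : Coeff d m) : Prop where
  sig_cont : ∀ i, Continuous fun x => c.sig x i
  b_cont : ∀ i, Continuous fun x => c.b x i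
  growth : ∃ C > (0 : ℝ), ∀ x i,
    (∑ k, ∑ l, |c.sig x i k l|) + ∑ k, |c.b x i k| ≤ C * (1 + ‖x‖)
  q_meas : ∀ i j, Measurable fun x => c.q x i j
  q_bdd : ∀ i j, ∃ C : ℝ, ∀ x, |c.q x i j| ≤ C
  q_nonneg : ∀ x i j, i ≠ j → 0 ≤ c.q x i j
  q_rowsum : ∀ x i, ∑ j, c.q x i j = 0
  ellipticity : ∀ D : Set (Rd d), BddDomain D →
    ∃ κ₀ ∈ Set.Ioc (0 : ℝ) 1, ∀ x ∈ D, ∀ (i : Fin m) (ξ : Rd d),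
      κ₀ * ‖ξ‖ ^ 2 ≤ ∑ k, ∑ l, ξ k * c.a x i k l * ξ l ∧
      ∑ k, ∑ l, ξ k * c.a x i k l * ξ l ≤ κ₀⁻¹ * ‖ξ‖ ^ 2
  pit_nonneg : ∀ x i z, 0 ≤ c.pit x i z
  pit_meas : ∀ i, Measurable fun p : Rd d × Rd d => c.pit p.1 i p.2
  levy : ∀ x i, (∫⁻ z, ENNReal.ofReal (min 1 (‖z‖ ^ 2)) ∂(c.π x i)) < ⊤
  bigjump : ∃ C : ℝ≥0∞, C < ⊤ ∧ ∀ x i, c.π x i (ball (0 : Rd d) 1)ᶜ ≤ C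
  smalljump : ∃ C > (0 : ℝ), ∀ x i,
    (∫⁻ z in ball (0 : Rd d) 1, ENNReal.ofReal (‖z‖ ^ 2) ∂(c.π x i))
      ≤ ENNReal.ofReal (C * (1 + ‖x‖ ^ 2))
  domination : ∀ n : ℕ, 1 ≤ n → ∃ Pin : Measure (Rd d), SigmaFinite Pin ∧
    (∫⁻ z, ENNReal.ofReal (min 1 (‖z‖ ^ 2)) ∂Pin) < ⊤ ∧
    ∀ x ∈ ball (0 : Rd d) n, ∀ i, c.π x i ≤ Pin
  comparability : ∃ κ₂ > (0 : ℝ), ∃ β > (0 : ℝ), ∀ r ∈ Set.Ioo (0 : ℝ) 1, ∃ αr : ℝ,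
    1 < αr ∧ αr < κ₂ * r ^ (-β) ∧
    ∀ (x₀ x y z : Rd d) (i : Fin m), x ∈ ball x₀ (r / 2) → y ∈ ball x₀ (r / 2) →
      z ∉ ball x₀ r → c.pit x i (z - x) ≤ αr * c.pit y i (z - y)

/-- `G` (that is, the matrix `Q(·)`) is strictly irreducible on `D`. -/
def StrictIrred (c : Coeff d m) (D : Set (Rd d)) : Prop :=
  ∀ i j : Fin m, i ≠ j → ∃ q0 > (0 : ℝ), ∀ x ∈ D, q0 ≤ c.q x i j

end Coeff

/-- The path space `D([0,∞), ℝ^d × {1,…,m})` of right-continuous functions with left limits. As a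
subtype of a product it carries the σ-algebra generated by the coordinates, which is the Borel
σ-algebra of the Skorokhod topology. -/
abbrev CadlagPath (d m : ℕ) : Type :=
  {w : ℝ≥0 → Rd d × Fin m //
    (∀ t, ContinuousWithinAt w (Set.Ici t) t) ∧
    ∀ t, 0 < t → ∃ L, Tendsto w (𝓝[<] t) (𝓝 L)}

namespace CadlagPath

variable {d m : ℕ}

/-- The component `X(t)` of the coordinate process. -/
def X (t : ℝ≥0) (w : CadlagPath d m) : Rd d := (w.1 t).1

/-- The component `Λ(t)` of the coordinate process. -/
def Λ (t : ℝ≥0) (w : CadlagPath d m) : Fin m := (w.1 t).2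

lemma measurable_coord (t : ℝ≥0) : Measurable fun w : CadlagPath d m => w.1 t :=
  (measurable_pi_apply t).comp measurable_subtype_coe

/-- The filtration `σ((X(s),Λ(s)) : s ≤ t)` generated by the coordinate process. -/
def rawFiltration (d m : ℕ) :
    Filtration ℝ≥0 (inferInstance : MeasurableSpace (CadlagPath d m)) where
  seq t := ⨆ s ≤ t, MeasurableSpace.comap (fun w : CadlagPath d m => w.1 s) inferInstance
  mono' _ _ hst := biSup_mono fun _ => ge_trans hst
  le' _ := iSup₂_le fun s _ => (measurable_coord s).comap_le

/-- The right-continuous filtration `ℱ_t = ⋂_{u > t} σ((X(s),Λ(s)) : s ≤ u)`. -/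
def filtration (d m : ℕ) :
    Filtration ℝ≥0 (inferInstance : MeasurableSpace (CadlagPath d m)) :=
  (rawFiltration d m).rightCont

/-- The shift `(θ_t w)(s) = w(t + s)`. -/
def shift (t : ℝ≥0) (w : CadlagPath d m) : CadlagPath d m :=
  ⟨fun s => w.1 (t + s), by
    refine ⟨fun s => ?_, fun s hs => ?_⟩
    · refine (w.2.1 (t + s)).comp (f := fun u => t + u)
        (continuous_const.add continuous_id).continuousWithinAt ?_
      intro u hu
      exact add_le_add_right (show s ≤ u from hu) t
    · obtain ⟨L, hL⟩ := w.2.2 (t + s) (by positivity)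
      refine ⟨L, hL.comp ?_⟩
      refine tendsto_nhdsWithin_of_tendsto_nhds_of_eventually_within _ ?_ ?_
      · exact ((continuous_const.add continuous_id).tendsto s).mono_left nhdsWithin_le_nhds
      · filter_upwards [self_mem_nhdsWithin] with u hu
        exact add_lt_add_right (show u < s from hu) t⟩

/-- `σ_D = inf{t ≥ 0 : X(t) ∈ D}`, with value `∞` if `X` never visits `D`. -/
def hit (D : Set (Rd d)) (w : CadlagPath d m) : ℝ≥0∞ :=
  ⨅ (t : ℝ≥0) (_ : X t w ∈ D), (t : ℝ≥0∞)

end CadlagPath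

open CadlagPath in
/-- `μ` solves the martingale problem for `(G, C_b²(ℝ^d))` started at `z = (x,i)`. The martingale
property is required for those `f` with `f(·,i) ∈ C_b²` for each `i` for which `Gf` is bounded: if
the coefficients grow and the jumps have heavy tails, the time integral of `Gf` need not be
integrable for other `f`. A measure with the martingale (or merely local martingale) property for
all `f` in `C_b²` has this one. -/
structure SolvesMP {d m : ℕ} (c : Coeff d m) (z : Rd d × Fin m)
    (μ : Measure (CadlagPath d m)) : Prop where
  init : μ {w | X 0 w = z.1 ∧ Λ 0 w = z.2} = 1
  mart : ∀ f : Rd d → Fin m → ℝ,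
    (∀ i, ContDiff ℝ 2 fun y => f y i) →
    (∀ i, ∃ C : ℝ, ∀ x, |f x i| ≤ C ∧ ‖fderiv ℝ (fun y => f y i) x‖ ≤ C ∧
        ‖iteratedFDeriv ℝ 2 (fun y => f y i) x‖ ≤ C) →
    (∃ C : ℝ, ∀ x i, |c.G f x i| ≤ C) →
    Martingale
      (fun (t : ℝ≥0) w => f (X t w) (Λ t w) - f (X 0 w) (Λ 0 w) -
        ∫ u in (0 : ℝ)..(t : ℝ), c.G f (X u.toNNReal w) (Λ u.toNNReal w))
      (filtration d m) μ

open CadlagPath in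
/-- The strong Markov property of the family `P`: for every stopping time `τ`, `B ∈ ℱ_τ` and
event `A`, `P_z(B ∩ {τ < ∞} ∩ θ_τ⁻¹ A) = E_z[1_{B ∩ {τ < ∞}} P_{(X(τ),Λ(τ))}(A)]`. -/
def StrongMarkov {d m : ℕ} (P : Kernel (Rd d × Fin m) (CadlagPath d m)) : Prop :=
  ∀ (z : Rd d × Fin m) (τ : CadlagPath d m → WithTop ℝ≥0)
    (hτ : IsStoppingTime (filtration d m) τ) (B A : Set (CadlagPath d m)),
    MeasurableSet[hτ.measurableSpace] B → MeasurableSet A →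
    P z (B ∩ {w | τ w < ⊤ ∧ shift ((τ w).untopD 0) w ∈ A}) =
      ∫⁻ w in B ∩ {w | τ w < ⊤}, P (X ((τ w).untopD 0) w, Λ ((τ w).untopD 0) w) A ∂(P z)

/-- `P = (P_{x,i})` is the family of laws of the switching jump diffusion with generator `G`: the
laws form a strong Markov family on the path space and solve the martingale problem. -/
structure IsSwitchingJumpDiffusion {d m : ℕ} (c : Coeff d m)
    (P : Kernel (Rd d × Fin m) (CadlagPath d m)) : Prop where
  prob : IsMarkovKernel P
  solves : ∀ z, SolvesMP c z (P z)
  strongMarkov : StrongMarkov P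

end

/-! ### Grid approximation of times from the right -/

/-- The smallest multiple of `1 / (n + 1)` that is strictly larger than `t`. -/
noncomputable def nextGrid (n : ℕ) (t : ℝ≥0) : ℝ≥0 := (⌊(n + 1) * t⌋₊ + 1) / (n + 1)

lemma lt_nextGrid (n : ℕ) (t : ℝ≥0) : t < nextGrid n t := by
  rw [nextGrid, lt_div_iff₀ (by positivity), mul_comm]
  exact Nat.lt_floor_add_one _

lemma nextGrid_le (n : ℕ) (t : ℝ≥0) : nextGrid n t ≤ t + 1 / (n + 1) := by
  have h0 : (0 : ℝ≥0) < n + 1 := by positivity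
  rw [nextGrid, div_le_iff₀ h0, add_mul t, div_mul_cancel₀ _ h0.ne', mul_comm t]
  gcongr
  exact Nat.floor_le (by positivity)

lemma nextGrid_le_iff (n : ℕ) (s t : ℝ≥0) :
    nextGrid n s ≤ t ↔ s < (⌊(n + 1) * t⌋₊ : ℝ≥0) / (n + 1) := by
  have h0 : (0 : ℝ≥0) < n + 1 := by positivity
  rw [nextGrid, div_le_iff₀ h0, lt_div_iff₀ h0, mul_comm t, mul_comm s]
  have : ((⌊(n + 1) * s⌋₊ : ℝ≥0) + 1) = ((⌊(n + 1) * s⌋₊ + 1 : ℕ) : ℝ≥0) := by push_cast; rfl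
  rw [this, ← Nat.le_floor_iff (by positivity), Nat.succ_le_iff, Nat.floor_lt (by positivity)]

lemma floor_div_le (n : ℕ) (t : ℝ≥0) : (⌊(n + 1) * t⌋₊ : ℝ≥0) / (n + 1) ≤ t := by
  rw [div_le_iff₀ (by positivity), mul_comm t]
  exact Nat.floor_le (by positivity)

lemma tendsto_nextGrid (t : ℝ≥0) : Tendsto (fun n => nextGrid n t) atTop (𝓝[≥] t) := by
  refine tendsto_nhdsWithin_of_tendsto_nhds_of_eventually_within _ ?_
    (Eventually.of_forall fun n => (lt_nextGrid n t).le)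
  refine tendsto_of_tendsto_of_tendsto_of_le_of_le tendsto_const_nhds ?_
    (fun n => (lt_nextGrid n t).le) (fun n => nextGrid_le n t)
  have : Tendsto (fun n : ℕ => (1 : ℝ≥0) / (n + 1)) atTop (𝓝 0) :=
    tendsto_one_div_add_atTop_nhds_zero_nat
  simpa using tendsto_const_nhds.add this

lemma measurable_of_rightContinuous {β : Type*} [TopologicalSpace β]
    [TopologicalSpace.PseudoMetrizableSpace β] [MeasurableSpace β] [BorelSpace β] {f : ℝ≥0 → β}
    (hf : ∀ t, ContinuousWithinAt f (Ici t) t) : Measurable f := by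
  refine measurable_of_tendsto_metrizable (f := fun n t => f (nextGrid n t)) (fun n => ?_) ?_
  · have h : Measurable fun t : ℝ≥0 => ⌊((n : ℝ≥0) + 1) * t⌋₊ :=
      Nat.measurable_floor.comp (measurable_const.mul measurable_id)
    exact (measurable_of_countable fun k : ℕ => f ((k + 1) / (n + 1))).comp h
  · exact tendsto_pi_nhds.2 fun t => (hf t).tendsto.comp (tendsto_nextGrid t)

/-! ### Optional stopping in continuous time -/

section OptionalStopping

variable {Ω : Type*} {mΩ : MeasurableSpace Ω} {μ : Measure Ω} [IsProbabilityMeasure μ]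
  {ℱ : Filtration ℝ≥0 mΩ}

lemma MeasureTheory.IsStoppingTime.min_nextGrid {τ : Ω → ℝ≥0}
    (hτ : IsStoppingTime ℱ fun ω => (τ ω : WithTop ℝ≥0)) (T : ℝ≥0) (n : ℕ) :
    IsStoppingTime ℱ fun ω => ((min T (nextGrid n (τ ω)) : ℝ≥0) : WithTop ℝ≥0) := by
  intro t
  by_cases hT : T ≤ t
  · have : {ω | ((min T (nextGrid n (τ ω)) : ℝ≥0) : WithTop ℝ≥0) ≤ t} = univ := by
      exact eq_univ_of_forall fun ω => WithTop.coe_le_coe.2 ((min_le_left _ _).trans hT)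
    rw [this]; exact MeasurableSet.univ
  · have : {ω | ((min T (nextGrid n (τ ω)) : ℝ≥0) : WithTop ℝ≥0) ≤ t} =
        {ω | (τ ω : WithTop ℝ≥0) < (((⌊(n + 1) * t⌋₊ : ℝ≥0) / (n + 1) : ℝ≥0) : WithTop ℝ≥0)} := by
      ext ω
      simp only [mem_ofPred_eq, WithTop.coe_le_coe, WithTop.coe_lt_coe, min_le_iff, hT, false_or,
        nextGrid_le_iff]
    rw [this]
    exact ℱ.mono (floor_div_le n t) _ (hτ.measurableSet_lt _)

/-- Optional stopping for a bounded stopping time and a martingale with bounded right-continuous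
paths. -/
lemma MeasureTheory.Martingale.integral_stopped_eq {M : ℝ≥0 → Ω → ℝ} (hM : Martingale M ℱ μ)
    {T : ℝ≥0} {K : ℝ}
    (hbd : ∀ s ≤ T, ∀ ω, |M s ω| ≤ K)
    (hrc : ∀ ω t, ContinuousWithinAt (fun s => M s ω) (Ici t) t) {τ : Ω → ℝ≥0}
    (hτ : IsStoppingTime ℱ fun ω => (τ ω : WithTop ℝ≥0)) (hτT : ∀ ω, τ ω ≤ T) :
    Integrable (fun ω => M (τ ω) ω) μ ∧ ∫ ω, M (τ ω) ω ∂μ = ∫ ω, M T ω ∂μ := by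
  let N : ℕ → Ω → ℝ := fun n ω => M (min T (nextGrid n (τ ω))) ω
  have hlim : ∀ ω, Tendsto (fun n => N n ω) atTop (𝓝 (M (τ ω) ω)) := by
    intro ω
    refine (hrc ω (τ ω)).tendsto.comp ?_
    refine tendsto_nhdsWithin_of_tendsto_nhds_of_eventually_within _ ?_
      (Eventually.of_forall fun n => le_min (hτT ω) (lt_nextGrid n _).le)
    have := (tendsto_nextGrid (τ ω)).mono_right nhdsWithin_le_nhds
    simpa [min_eq_right (hτT ω)] using tendsto_const_nhds (x := T).min this
  have hN : ∀ n, AEStronglyMeasurable (N n) μ ∧ ∫ ω, N n ω ∂μ = ∫ ω, M T ω ∂μ := by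
    intro n
    have hst := IsStoppingTime.min_nextGrid hτ T n
    have hle : ∀ ω, ((min T (nextGrid n (τ ω)) : ℝ≥0) : WithTop ℝ≥0) ≤ T := fun ω =>
      WithTop.coe_le_coe.2 (min_le_left _ _)
    have hcount : (range fun ω => ((min T (nextGrid n (τ ω)) : ℝ≥0) : WithTop ℝ≥0)).Countable := by
      refine (countable_range fun k : ℕ =>
        ((min T (((k : ℝ≥0) + 1) / (n + 1)) : ℝ≥0) : WithTop ℝ≥0)).mono ?_
      rintro _ ⟨ω, rfl⟩
      exact ⟨⌊(n + 1) * τ ω⌋₊, rfl⟩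
    have h := hM.stoppedValue_ae_eq_condExp_of_le_const_of_countable_range hst hle hcount
    have h' : N n =ᵐ[μ] μ[M T | hst.measurableSpace] := h
    refine ⟨?_, ?_⟩
    · exact (stronglyMeasurable_condExp.mono hst.measurableSpace_le).aestronglyMeasurable.congr
        h'.symm
    · rw [integral_congr_ae h', integral_condExp]
  have hbdN : ∀ n, ∀ᵐ ω ∂μ, ‖N n ω‖ ≤ K := fun n => Eventually.of_forall fun ω =>
    hbd _ (min_le_left _ _) ω
  have hmeas : AEStronglyMeasurable (fun ω => M (τ ω) ω) μ :=
    aestronglyMeasurable_of_tendsto_ae atTop (fun n => (hN n).1) (Eventually.of_forall hlim)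
  refine ⟨Integrable.of_bound hmeas K (Eventually.of_forall fun ω => hbd _ (hτT ω) ω), ?_⟩
  have h1 := tendsto_integral_of_dominated_convergence (fun _ => K) (fun n => (hN n).1)
    (integrable_const K) hbdN (Eventually.of_forall hlim)
  simp only [(hN _).2] at h1
  exact tendsto_nhds_unique h1 tendsto_const_nhds

end OptionalStopping

/-! ### Hitting times of open sets -/

namespace CadlagPath

variable {d m : ℕ}

lemma hit_lt_iff {U : Set (Rd d)} {w : CadlagPath d m} {a : ℝ≥0∞} :
    hit U w < a ↔ ∃ t : ℝ≥0, X t w ∈ U ∧ (t : ℝ≥0∞) < a := by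
  simp [hit, iInf_lt_iff]

lemma hit_lt_top_iff {U : Set (Rd d)} {w : CadlagPath d m} :
    hit U w < ⊤ ↔ ∃ t : ℝ≥0, X t w ∈ U := by
  simp [hit_lt_iff]

lemma hit_le {U : Set (Rd d)} {w : CadlagPath d m} {t : ℝ≥0} (h : X t w ∈ U) : hit U w ≤ t :=
  iInf₂_le t h

lemma X_rightContinuous (w : CadlagPath d m) (t : ℝ≥0) :
    ContinuousWithinAt (fun s => X s w) (Ici t) t :=
  continuous_fst.continuousAt.comp_continuousWithinAt (w.2.1 t)

lemma hit_lt_coe_iff {U : Set (Rd d)} (hU : IsOpen U) {w : CadlagPath d m} {t : ℝ≥0} :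
    hit U w < t ↔ ∃ n, X (TopologicalSpace.denseSeq ℝ≥0 n) w ∈ U ∧
      TopologicalSpace.denseSeq ℝ≥0 n < t := by
  rw [hit_lt_iff]
  constructor
  · rintro ⟨s, hs, hst⟩
    have hst' : s < t := by exact_mod_cast hst
    have h1 : ∀ᶠ u in 𝓝[≥] s, X u w ∈ U := (X_rightContinuous w s).eventually (hU.mem_nhds hs)
    obtain ⟨v, hv, hsub⟩ := (mem_nhdsGE_iff_exists_Ico_subset' hst').1 h1
    have hne : (Ioo s (min v t)).Nonempty := nonempty_Ioo.2 (lt_min hv hst')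
    obtain ⟨n, hn⟩ := (TopologicalSpace.denseRange_denseSeq ℝ≥0).exists_mem_open isOpen_Ioo hne
    exact ⟨n, hsub ⟨hn.1.le, hn.2.trans_le (min_le_left _ _)⟩, hn.2.trans_le (min_le_right _ _)⟩
  · rintro ⟨n, h1, h2⟩
    exact ⟨_, h1, by exact_mod_cast h2⟩

lemma measurableSet_X_mem (s : ℝ≥0) {U : Set (Rd d)} (hU : MeasurableSet U) :
    MeasurableSet[filtration d m s] {w | X s w ∈ U} := by
  refine (rawFiltration d m).le_rightCont s _ ?_
  have h : MeasurableSpace.comap (fun w : CadlagPath d m => w.1 s) inferInstance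
      ≤ rawFiltration d m s :=
    le_iSup₂ (f := fun r (_ : r ≤ s) =>
      MeasurableSpace.comap (fun w : CadlagPath d m => w.1 r) inferInstance) s le_rfl
  exact h _ ⟨Prod.fst ⁻¹' U, measurable_fst hU, rfl⟩

instance : (filtration d m).IsRightContinuous :=
  inferInstanceAs (rawFiltration d m).rightCont.IsRightContinuous

lemma isStoppingTime_hit {U : Set (Rd d)} (hU : IsOpen U) :
    IsStoppingTime (filtration d m) (fun w => (hit U w : WithTop ℝ≥0)) := by
  refine isStoppingTime_of_measurableSet_lt_of_isRightContinuous fun t => ?_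
  change MeasurableSet[filtration d m t] {w : CadlagPath d m | hit U w < (t : ℝ≥0∞)}
  have : {w : CadlagPath d m | hit U w < (t : ℝ≥0∞)} =
      ⋃ n, {w | X (TopologicalSpace.denseSeq ℝ≥0 n) w ∈ U ∧
        TopologicalSpace.denseSeq ℝ≥0 n < t} := by
    ext w
    rw [mem_iUnion]
    exact hit_lt_coe_iff hU
  rw [this]
  refine MeasurableSet.iUnion fun n => ?_
  by_cases hn : TopologicalSpace.denseSeq ℝ≥0 n < t
  · simp only [hn, and_true]
    exact (filtration d m).mono hn.le _ (measurableSet_X_mem _ hU.measurableSet)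
  · simp [hn]

lemma measurableSet_hit_lt_top {U : Set (Rd d)} (hU : IsOpen U) :
    MeasurableSet {w : CadlagPath d m | hit U w < ⊤} := by
  have : {w : CadlagPath d m | hit U w < ⊤} = ⋃ n : ℕ, {w | hit U w < ((n : ℝ≥0) : ℝ≥0∞)} := by
    ext w
    simp only [mem_ofPred_eq, mem_iUnion]
    refine ⟨fun h => ?_, fun ⟨n, hn⟩ => hn.trans ENNReal.coe_lt_top⟩
    obtain ⟨n, hn⟩ := ENNReal.exists_nat_gt h.ne
    exact ⟨n, by exact_mod_cast hn⟩
  rw [this]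
  exact MeasurableSet.iUnion fun n =>
    (filtration d m).le _ _ ((isStoppingTime_hit hU).measurableSet_lt (n : ℝ≥0))

lemma X_hit_mem_closure {U : Set (Rd d)} {w : CadlagPath d m} {t : ℝ≥0} (h : hit U w = t) :
    X t w ∈ closure U := by
  have hc := (X_rightContinuous w t).tendsto
  refine mem_closure_of_frequently_of_tendsto ?_ hc
  rw [frequently_nhdsWithin_iff]
  by_contra hcon
  rw [not_frequently] at hcon
  have h1 : ∀ᶠ u in 𝓝[≥] t, X u w ∉ U := by
    rw [eventually_nhdsWithin_iff]
    filter_upwards [hcon] with u hu hut hU using hu ⟨hU, hut⟩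
  obtain ⟨v, hv, hsub⟩ := (mem_nhdsGE_iff_exists_Ico_subset' (lt_add_one t)).1 h1
  have h2 : hit U w < v := by rw [h]; exact_mod_cast hv
  obtain ⟨s, hs, hsv⟩ := hit_lt_iff.1 h2
  have hts : t ≤ s := by have := hit_le hs; rw [h] at this; exact_mod_cast this
  exact hsub ⟨hts, by exact_mod_cast hsv⟩ hs

lemma notMem_of_lt_hit {U : Set (Rd d)} {w : CadlagPath d m} {t : ℝ≥0} (h : (t : ℝ≥0∞) < hit U w) :
    X t w ∉ U := fun hU => (hit_le hU).not_gt h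

end CadlagPath

/-! ### The Gaussian barrier function -/

section Gauss

variable {d : ℕ}

/-- The function `x ↦ exp (-lam |x - x₀|²)`. -/
noncomputable def gauss (lam : ℝ) (x₀ x : Rd d) : ℝ := Real.exp (-lam * ‖x - x₀‖ ^ 2)

variable {lam : ℝ} {x₀ : Rd d}

lemma gauss_pos (x : Rd d) : 0 < gauss lam x₀ x := Real.exp_pos _

lemma gauss_le_one (hlam : 0 ≤ lam) (x : Rd d) : gauss lam x₀ x ≤ 1 := by
  rw [gauss, Real.exp_le_one_iff]
  nlinarith [mul_nonneg hlam (sq_nonneg ‖x - x₀‖)]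

lemma contDiff_gauss {n : WithTop ℕ∞} : ContDiff ℝ n (gauss lam x₀) :=
  (contDiff_const.mul ((contDiff_id.sub contDiff_const).norm_sq ℝ)).exp

lemma continuous_gauss : Continuous (gauss lam x₀) := (contDiff_gauss (n := 0)).continuous

lemma hasFDerivAt_gauss (x : Rd d) :
    HasFDerivAt (gauss lam x₀) ((-2 * lam * gauss lam x₀ x) • innerSL ℝ (x - x₀)) x := by
  have h1 : HasFDerivAt (fun y : Rd d => ‖y - x₀‖ ^ 2) (2 • innerSL ℝ (x - x₀)) x := by
    have := ((hasFDerivAt_id x).sub_const x₀).norm_sq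
    simpa using this
  have h2 := (h1.const_mul (-lam)).exp
  refine h2.congr_fderiv ?_
  ext h
  simp [gauss]
  ring

lemma fderiv_gauss :
    fderiv ℝ (gauss lam x₀) = fun x => (-2 * lam * gauss lam x₀ x) • innerSL ℝ (x - x₀) :=
  funext fun x => (hasFDerivAt_gauss x).fderiv

lemma fderiv_gauss_apply (x h : Rd d) :
    fderiv ℝ (gauss lam x₀) x h = -2 * lam * gauss lam x₀ x * inner ℝ (x - x₀) h := by
  rw [fderiv_gauss]; rfl

lemma iteratedFDeriv_two_gauss (x : Rd d) (v : Fin 2 → Rd d) :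
    iteratedFDeriv ℝ 2 (gauss lam x₀) x v = gauss lam x₀ x *
      (4 * lam ^ 2 * inner ℝ (x - x₀) (v 0) * inner ℝ (x - x₀) (v 1)
        - 2 * lam * inner ℝ (v 0) (v 1)) := by
  rw [iteratedFDeriv_two_apply, fderiv_gauss]
  have h1 : HasFDerivAt (fun y : Rd d => innerSL ℝ (y - x₀)) (innerSL ℝ (E := Rd d)) x := by
    exact (innerSL ℝ (E := Rd d)).hasFDerivAt.comp x ((hasFDerivAt_id x).sub_const x₀)
  have h2 := ((hasFDerivAt_gauss (lam := lam) (x₀ := x₀) x).const_mul (-2 * lam)).smul h1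
  have h3 : fderiv ℝ (fun y => (-2 * lam * gauss lam x₀ y) • innerSL ℝ (y - x₀)) x = _ := h2.fderiv
  rw [h3]
  have h4 : innerSL ℝ (v 0) (v 1) = inner ℝ (v 0) (v 1) := rfl
  simp only [_root_.add_apply, _root_.smul_apply, ContinuousLinearMap.smulRight_apply,
    innerSL_apply_apply, smul_eq_mul]
  rw [h4]
  ring

lemma norm_fderiv_gauss_le (hlam : 0 ≤ lam) (x : Rd d) :
    ‖fderiv ℝ (gauss lam x₀) x‖ ≤ 2 * lam * ‖x - x₀‖ * gauss lam x₀ x := by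
  have hg := (gauss_pos (lam := lam) (x₀ := x₀) x).le
  refine ContinuousLinearMap.opNorm_le_bound _ (by positivity) fun h => ?_
  rw [fderiv_gauss_apply, norm_mul, Real.norm_eq_abs, Real.norm_eq_abs, abs_mul, abs_mul,
    abs_of_nonneg hlam, abs_of_nonneg hg]
  have := mul_le_mul_of_nonneg_left (abs_real_inner_le_norm (x - x₀) h)
    (by positivity : 0 ≤ 2 * lam * gauss lam x₀ x)
  norm_num
  linarith

lemma abs_iteratedFDeriv_two_gauss_le (hlam : 0 ≤ lam) (x : Rd d) (v : Fin 2 → Rd d) :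
    |iteratedFDeriv ℝ 2 (gauss lam x₀) x v| ≤
      (4 * lam ^ 2 * ‖x - x₀‖ ^ 2 + 2 * lam) * gauss lam x₀ x * (‖v 0‖ * ‖v 1‖) := by
  have hg := (gauss_pos (lam := lam) (x₀ := x₀) x).le
  rw [iteratedFDeriv_two_gauss, abs_mul, abs_of_nonneg hg, mul_comm _ (gauss lam x₀ x),
    mul_assoc (gauss lam x₀ x)]
  refine mul_le_mul_of_nonneg_left ((abs_sub _ _).trans ?_) hg
  rw [abs_mul, abs_mul, abs_mul (2 * lam), abs_of_nonneg (by positivity : 0 ≤ 4 * lam ^ 2),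
    abs_of_nonneg (by positivity : 0 ≤ 2 * lam), add_mul]
  refine add_le_add ?_ (mul_le_mul_of_nonneg_left (abs_real_inner_le_norm _ _) (by positivity))
  calc 4 * lam ^ 2 * |inner ℝ (x - x₀) (v 0)| * |inner ℝ (x - x₀) (v 1)|
      ≤ 4 * lam ^ 2 * (‖x - x₀‖ * ‖v 0‖) * (‖x - x₀‖ * ‖v 1‖) := by
        gcongr <;> exact abs_real_inner_le_norm _ _
    _ = _ := by ring

/-- The Gaussian beats polynomials. -/
lemma poly_mul_exp_le (hlam : 0 < lam) {s : ℝ} (hs : 0 ≤ s) :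
    (1 + s) ^ 4 * Real.exp (-lam * s ^ 2 + 2 * lam * s) ≤
      Real.exp ((4 + 2 * lam) ^ 2 / (4 * lam)) := by
  have h1 : (1 + s) ^ 4 ≤ Real.exp (4 * s) := by
    rw [show 4 * s = ((4 : ℕ) : ℝ) * s by norm_num, Real.exp_nat_mul]
    gcongr
    linarith [Real.add_one_le_exp s]
  calc _ ≤ Real.exp (4 * s) * Real.exp (-lam * s ^ 2 + 2 * lam * s) := by gcongr
    _ = Real.exp (4 * s + (-lam * s ^ 2 + 2 * lam * s)) := (Real.exp_add _ _).symm
    _ ≤ _ := by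
        apply Real.exp_le_exp.2
        rw [le_div_iff₀ (by positivity)]
        nlinarith [sq_nonneg (4 + 2 * lam - 2 * lam * s)]

lemma gauss_le_exp (hlam : 0 < lam) (x : Rd d) :
    gauss lam x₀ x ≤ Real.exp (-lam * ‖x - x₀‖ ^ 2 + 2 * lam * ‖x - x₀‖) := by
  apply Real.exp_le_exp.2
  have : 0 ≤ 2 * lam * ‖x - x₀‖ := by positivity
  linarith

lemma poly_mul_gauss_le (hlam : 0 < lam) (x : Rd d) :
    (1 + ‖x - x₀‖) ^ 4 * gauss lam x₀ x ≤ Real.exp ((4 + 2 * lam) ^ 2 / (4 * lam)) :=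
  (mul_le_mul_of_nonneg_left (gauss_le_exp hlam x) (by positivity)).trans
    (poly_mul_exp_le hlam (norm_nonneg _))

lemma gauss_bounded_derivatives (hlam : 0 < lam) :
    ∃ C : ℝ, ∀ x : Rd d, |gauss lam x₀ x| ≤ C ∧ ‖fderiv ℝ (gauss lam x₀) x‖ ≤ C ∧
      ‖iteratedFDeriv ℝ 2 (gauss lam x₀) x‖ ≤ C := by
  set K := Real.exp ((4 + 2 * lam) ^ 2 / (4 * lam)) with hK
  have hK0 : 0 < K := Real.exp_pos _
  refine ⟨(4 * lam ^ 2 + 2 * lam + 1) * K, fun x => ?_⟩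
  have hg := gauss_pos (lam := lam) (x₀ := x₀) x
  have hs := norm_nonneg (x - x₀)
  have hp := poly_mul_gauss_le (x₀ := x₀) hlam x
  rw [← hK] at hp
  set s := ‖x - x₀‖
  set g := gauss lam x₀ x
  have e1 : 1 ≤ (1 + s) ^ 4 := one_le_pow₀ (by linarith)
  have e2 : (1 + s) ^ 2 ≤ (1 + s) ^ 4 := pow_le_pow_right₀ (by linarith) (by norm_num)
  have e3 : s ≤ (1 + s) ^ 4 := le_trans (by nlinarith) e2
  have e4 : s ^ 2 ≤ (1 + s) ^ 4 := le_trans (by nlinarith) e2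
  have f1 : g ≤ K := by nlinarith
  have f3 : s * g ≤ K := (mul_le_mul_of_nonneg_right e3 hg.le).trans hp
  have f4 : s ^ 2 * g ≤ K := (mul_le_mul_of_nonneg_right e4 hg.le).trans hp
  have l1 : 0 < lam ^ 2 * K := by positivity
  have l2 : 0 < lam * K := by positivity
  refine ⟨?_, (norm_fderiv_gauss_le hlam.le x).trans ?_, ?_⟩
  · rw [abs_of_pos hg]; nlinarith
  · nlinarith [mul_le_mul_of_nonneg_left f3 hlam.le]
  · refine ContinuousMultilinearMap.opNorm_le_bound (by positivity) fun v => ?_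
    rw [Fin.prod_univ_two]
    refine (abs_iteratedFDeriv_two_gauss_le hlam.le x v).trans ?_
    refine mul_le_mul_of_nonneg_right ?_ (by positivity)
    nlinarith [mul_le_mul_of_nonneg_left f4 (sq_nonneg lam), mul_le_mul_of_nonneg_left f1 hlam.le]

/-! ### The jump term -/

/-- The integrand of the jump part of the generator applied to `gauss`. -/
noncomputable def gaussJump (lam : ℝ) (x₀ x z : Rd d) : ℝ :=
  gauss lam x₀ (x + z) - gauss lam x₀ x -
    (if ‖z‖ < 1 then fderiv ℝ (gauss lam x₀) x z else 0)

lemma measurable_gaussJump :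
    Measurable fun p : Rd d × Rd d => gaussJump lam x₀ p.1 p.2 := by
  unfold gaussJump
  simp only [fderiv_gauss_apply]
  have hg : Measurable (gauss lam x₀) := continuous_gauss.measurable
  refine ((hg.comp (measurable_fst.add measurable_snd)).sub (hg.comp measurable_fst)).sub ?_
  refine Measurable.ite (measurableSet_lt measurable_snd.norm measurable_const) ?_ measurable_const
  exact (measurable_const.mul (hg.comp measurable_fst)).mul
    ((measurable_fst.sub measurable_const).inner measurable_snd)

lemma gauss_add (x z : Rd d) : gauss lam x₀ (x + z) =
    gauss lam x₀ x * Real.exp (-lam * (2 * inner ℝ (x - x₀) z + ‖z‖ ^ 2)) := by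
  rw [gauss, gauss, ← Real.exp_add, add_sub_right_comm, norm_add_sq_real]
  congr 1
  ring

lemma neg_le_gaussJump (hlam : 0 ≤ lam) (x z : Rd d) :
    -((lam + 1) * gauss lam x₀ x) * min 1 (‖z‖ ^ 2) ≤ gaussJump lam x₀ x z := by
  have hg := gauss_pos (lam := lam) (x₀ := x₀) x
  unfold gaussJump
  split_ifs with hz
  · rw [min_eq_right (by nlinarith [norm_nonneg z]), fderiv_gauss_apply, gauss_add]
    have h1 := Real.add_one_le_exp (-lam * (2 * inner ℝ (x - x₀) z + ‖z‖ ^ 2))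
    have h2 : 0 ≤ gauss lam x₀ x * ‖z‖ ^ 2 := by positivity
    nlinarith [mul_le_mul_of_nonneg_left h1 hg.le]
  · rw [min_eq_left (by nlinarith [norm_nonneg z])]
    have := gauss_pos (lam := lam) (x₀ := x₀) (x + z)
    nlinarith [mul_nonneg hlam hg.le]

lemma abs_gaussJump_le_one (hlam : 0 ≤ lam) (x : Rd d) {z : Rd d} (hz : 1 ≤ ‖z‖) :
    |gaussJump lam x₀ x z| ≤ 1 := by
  unfold gaussJump
  rw [if_neg hz.not_gt, sub_zero, abs_le]
  have h1 := gauss_pos (lam := lam) (x₀ := x₀) x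
  have h2 := gauss_pos (lam := lam) (x₀ := x₀) (x + z)
  have h3 := gauss_le_one (x₀ := x₀) hlam x
  have h4 := gauss_le_one (x₀ := x₀) hlam (x + z)
  constructor <;> linarith

lemma exp_sub_one_sub_le (u : ℝ) : Real.exp u - 1 - u ≤ u ^ 2 * Real.exp (max u 0) := by
  rcases le_total u 0 with hu | hu
  · rw [max_eq_right hu, Real.exp_zero, mul_one]
    rcases le_total (-1) u with h | h
    · have := Real.abs_exp_sub_one_sub_id_le (abs_le.2 ⟨h, by linarith⟩)
      exact (le_abs_self _).trans this
    · have : Real.exp u ≤ 1 := Real.exp_le_one_iff.2 hu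
      nlinarith
  · rw [max_eq_left hu]
    have h1 := Real.add_one_le_exp (-u)
    have h2 : Real.exp u * Real.exp (-u) = 1 := by rw [← Real.exp_add]; simp
    have h3 := Real.exp_pos u
    have h4 : Real.exp u - 1 ≤ u * Real.exp u := by nlinarith
    nlinarith

lemma abs_gaussJump_le (hlam : 0 < lam) (x : Rd d) {z : Rd d} (hz : ‖z‖ < 1) :
    |gaussJump lam x₀ x z| ≤ Real.exp (-lam * ‖x - x₀‖ ^ 2 + 2 * lam * ‖x - x₀‖) *
      ((4 * lam ^ 2 + lam) * (1 + ‖x - x₀‖) ^ 2) * ‖z‖ ^ 2 := by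
  have hg := gauss_pos (lam := lam) (x₀ := x₀) x
  have hgE := gauss_le_exp (x₀ := x₀) hlam x
  set u := -lam * (2 * inner ℝ (x - x₀) z + ‖z‖ ^ 2) with hu
  have hz0 := norm_nonneg z
  have hin := abs_le.1 (abs_real_inner_le_norm (x - x₀) z)
  have hs := norm_nonneg (x - x₀)
  have hEm : gauss lam x₀ x * Real.exp (max u 0) ≤
      Real.exp (-lam * ‖x - x₀‖ ^ 2 + 2 * lam * ‖x - x₀‖) := by
    rw [gauss, ← Real.exp_add]
    apply Real.exp_le_exp.2
    have h1 : max u 0 ≤ 2 * lam * ‖x - x₀‖ := by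
      refine max_le ?_ (by positivity)
      have h2 : -inner ℝ (x - x₀) z ≤ ‖x - x₀‖ := by nlinarith
      have h3 : 0 ≤ lam * ‖z‖ ^ 2 := by positivity
      nlinarith [mul_le_mul_of_nonneg_left h2 hlam.le]
    linarith
  have hJ : gaussJump lam x₀ x z = gauss lam x₀ x * (Real.exp u - 1 - u)
      - lam * gauss lam x₀ x * ‖z‖ ^ 2 := by
    unfold gaussJump
    rw [if_pos hz, fderiv_gauss_apply, gauss_add, hu]
    ring
  have hu2 : u ^ 2 ≤ 4 * lam ^ 2 * (1 + ‖x - x₀‖) ^ 2 * ‖z‖ ^ 2 := by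
    have h1 : |u| ≤ 2 * lam * (1 + ‖x - x₀‖) * ‖z‖ := by
      rw [hu, abs_mul, abs_neg, abs_of_pos hlam]
      have h2 : |2 * inner ℝ (x - x₀) z + ‖z‖ ^ 2| ≤ 2 * (1 + ‖x - x₀‖) * ‖z‖ := by
        rw [abs_le]; constructor <;> nlinarith
      nlinarith [mul_le_mul_of_nonneg_left h2 hlam.le]
    rw [← sq_abs]
    calc |u| ^ 2 ≤ (2 * lam * (1 + ‖x - x₀‖) * ‖z‖) ^ 2 := by gcongr
      _ = _ := by ring
  have hlow : 0 ≤ gauss lam x₀ x * (Real.exp u - 1 - u) :=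
    mul_nonneg hg.le (by linarith [Real.add_one_le_exp u])
  have hup : gauss lam x₀ x * (Real.exp u - 1 - u) ≤
      Real.exp (-lam * ‖x - x₀‖ ^ 2 + 2 * lam * ‖x - x₀‖) *
        (4 * lam ^ 2 * (1 + ‖x - x₀‖) ^ 2 * ‖z‖ ^ 2) := by
    calc _ ≤ gauss lam x₀ x * (u ^ 2 * Real.exp (max u 0)) :=
          mul_le_mul_of_nonneg_left (exp_sub_one_sub_le u) hg.le
      _ = (gauss lam x₀ x * Real.exp (max u 0)) * u ^ 2 := by ring
      _ ≤ _ := by gcongr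
  have hl : lam * gauss lam x₀ x * ‖z‖ ^ 2 ≤
      Real.exp (-lam * ‖x - x₀‖ ^ 2 + 2 * lam * ‖x - x₀‖) *
        (lam * (1 + ‖x - x₀‖) ^ 2 * ‖z‖ ^ 2) := by
    have h1 : 1 ≤ (1 + ‖x - x₀‖) ^ 2 := one_le_pow₀ (by linarith)
    calc lam * gauss lam x₀ x * ‖z‖ ^ 2 = gauss lam x₀ x * (lam * 1 * ‖z‖ ^ 2) := by ring
      _ ≤ _ := by gcongr
  have hl0 : 0 ≤ lam * gauss lam x₀ x * ‖z‖ ^ 2 := by positivity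
  have hE := Real.exp_pos (-lam * ‖x - x₀‖ ^ 2 + 2 * lam * ‖x - x₀‖)
  rw [hJ, abs_le]
  have hadd : Real.exp (-lam * ‖x - x₀‖ ^ 2 + 2 * lam * ‖x - x₀‖) *
      ((4 * lam ^ 2 + lam) * (1 + ‖x - x₀‖) ^ 2) * ‖z‖ ^ 2 =
      Real.exp (-lam * ‖x - x₀‖ ^ 2 + 2 * lam * ‖x - x₀‖) *
        (4 * lam ^ 2 * (1 + ‖x - x₀‖) ^ 2 * ‖z‖ ^ 2) +
      Real.exp (-lam * ‖x - x₀‖ ^ 2 + 2 * lam * ‖x - x₀‖) *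
        (lam * (1 + ‖x - x₀‖) ^ 2 * ‖z‖ ^ 2) := by ring
  rw [hadd]
  constructor <;> linarith

end Gauss

/-! ### The generator applied to the barrier -/

namespace Coeff

variable {d m : ℕ} {c : Coeff d m} {lam : ℝ} {x₀ : Rd d}

lemma G_gauss (hc : c.Standing) (x : Rd d) (i : Fin m) :
    c.G (fun y _ => gauss lam x₀ y) x i =
      gauss lam x₀ x * (2 * lam ^ 2 * (∑ k, ∑ l, (x - x₀) k * c.a x i k l * (x - x₀) l)
        - lam * ∑ k, c.a x i k k - 2 * lam * ∑ k, c.b x i k * (x - x₀) k)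
      + ∫ z, gaussJump lam x₀ x z ∂(c.π x i) := by
  have hq : ∑ j, c.q x i j * gauss lam x₀ x = 0 := by
    rw [← Finset.sum_mul, hc.q_rowsum, zero_mul]
  have h1 : ∑ k, ∑ l, c.a x i k l * iteratedFDeriv ℝ 2 (gauss lam x₀) x
        ![EuclideanSpace.single k (1 : ℝ), EuclideanSpace.single l (1 : ℝ)] =
      gauss lam x₀ x * (4 * lam ^ 2 * (∑ k, ∑ l, (x - x₀) k * c.a x i k l * (x - x₀) l)
        - 2 * lam * ∑ k, c.a x i k k) := by
    have h2 : ∀ k l, c.a x i k l * iteratedFDeriv ℝ 2 (gauss lam x₀) x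
        ![EuclideanSpace.single k (1 : ℝ), EuclideanSpace.single l (1 : ℝ)] =
        gauss lam x₀ x * (4 * lam ^ 2 * ((x - x₀) k * c.a x i k l * (x - x₀) l)
          - 2 * lam * (if k = l then c.a x i k l else 0)) := by
      intro k l
      rw [iteratedFDeriv_two_gauss]
      simp only [cons_val_zero, cons_val_one, EuclideanSpace.inner_single_right]
      by_cases hkl : k = l
      · subst hkl; simp; ring
      · simp [hkl]; ring
    simp only [h2, ← Finset.mul_sum, Finset.sum_sub_distrib, Finset.sum_ite_eq, Finset.mem_univ,
      if_true]
  have h3 : ∑ k, c.b x i k * fderiv ℝ (gauss lam x₀) x (EuclideanSpace.single k (1 : ℝ)) =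
      gauss lam x₀ x * (- 2 * lam * ∑ k, c.b x i k * (x - x₀) k) := by
    rw [Finset.mul_sum, Finset.mul_sum]
    refine Finset.sum_congr rfl fun k _ => ?_
    rw [fderiv_gauss_apply]
    simp only [EuclideanSpace.inner_single_right]
    simp
    ring
  have hG : c.G (fun y _ => gauss lam x₀ y) x i =
      (1 / 2) * ∑ k, ∑ l, c.a x i k l * iteratedFDeriv ℝ 2 (gauss lam x₀) x
          ![EuclideanSpace.single k (1 : ℝ), EuclideanSpace.single l (1 : ℝ)]
        + ∑ k, c.b x i k * fderiv ℝ (gauss lam x₀) x (EuclideanSpace.single k (1 : ℝ))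
        + ∫ z, gaussJump lam x₀ x z ∂(c.π x i) + ∑ j, c.q x i j * gauss lam x₀ x := rfl
  rw [hG, h1, h3, hq]
  ring

lemma pit_measurable (hc : c.Standing) (x : Rd d) (i : Fin m) : Measurable (c.pit x i) :=
  (hc.pit_meas i).comp measurable_prodMk_left

lemma continuous_a (hc : c.Standing) (i : Fin m) (k l : Fin d) :
    Continuous fun x => c.a x i k l := by
  have := (hc.sig_cont i).matrix_mul (hc.sig_cont i).matrix_transpose
  exact this.matrix_elem k l

lemma measurable_G_gauss (hc : c.Standing) :
    Measurable fun p : Rd d × Fin m => c.G (fun y _ => gauss lam x₀ y) p.1 p.2 := by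
  refine measurable_from_prod_countable_left fun i => ?_
  simp only [G_gauss hc]
  have hb : ∀ k, Continuous fun x => c.b x i k := fun k =>
    (EuclideanSpace.proj k : Rd d →L[ℝ] ℝ).continuous.comp (hc.b_cont i)
  have hy : ∀ k, Continuous fun x : Rd d => (x - x₀) k := fun k =>
    (EuclideanSpace.proj k : Rd d →L[ℝ] ℝ).continuous.comp (continuous_id.sub continuous_const)
  have ha := continuous_a hc i
  refine Measurable.add (Continuous.measurable ?_) ?_
  · refine continuous_gauss.mul ((Continuous.sub ?_ ?_).sub ?_)
    · exact continuous_const.mul (continuous_finsetSum _ fun k _ => continuous_finsetSum _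
        fun l _ => ((hy k).mul (ha k l)).mul (hy l))
    · exact continuous_const.mul (continuous_finsetSum _ fun k _ => ha k k)
    · exact continuous_const.mul (continuous_finsetSum _ fun k _ => (hb k).mul (hy k))
  · have h : ∀ x, ∫ z, gaussJump lam x₀ x z ∂(c.π x i) =
        ∫ z, c.pit x i z * gaussJump lam x₀ x z := by
      intro x
      rw [Coeff.π, integral_withDensity_eq_integral_toReal_smul
        (pit_measurable hc x i).ennreal_ofReal (Eventually.of_forall fun z => ENNReal.ofReal_lt_top)]
      refine integral_congr_ae (Eventually.of_forall fun z => ?_)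
      simp [ENNReal.toReal_ofReal (hc.pit_nonneg x i z)]
    simp only [h]
    have hm : StronglyMeasurable fun p : Rd d × Rd d =>
        c.pit p.1 i p.2 * gaussJump lam x₀ p.1 p.2 :=
      ((hc.pit_meas i).mul measurable_gaussJump).stronglyMeasurable
    exact hm.integral_prod_right.measurable

/-- Integrability of the jump term, with a bound uniform in the state. -/
lemma exists_lintegral_gaussJump_le (hc : c.Standing) (hlam : 0 < lam) (x₀ : Rd d) :
    ∃ K : ℝ≥0, ∀ x i, ∫⁻ z, ‖gaussJump lam x₀ x z‖ₑ ∂(c.π x i) ≤ K := by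
  obtain ⟨C, hC, hsmall⟩ := hc.smalljump
  obtain ⟨C', hC', hbig⟩ := hc.bigjump
  set Kx := Real.exp ((4 + 2 * lam) ^ 2 / (4 * lam)) with hKx
  refine ⟨(C * (1 + ‖x₀‖) ^ 2 * (4 * lam ^ 2 + lam) * Kx).toNNReal + C'.toNNReal, fun x i => ?_⟩
  set W := Real.exp (-lam * ‖x - x₀‖ ^ 2 + 2 * lam * ‖x - x₀‖) *
      ((4 * lam ^ 2 + lam) * (1 + ‖x - x₀‖) ^ 2) with hW
  have hW0 : 0 ≤ W := by positivity
  rw [← lintegral_add_compl _ (measurableSet_ball (x := (0 : Rd d)) (ε := 1)), ENNReal.coe_add,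
    ENNReal.coe_toNNReal hC'.ne]
  refine add_le_add ?_ ?_
  · calc ∫⁻ z in ball 0 1, ‖gaussJump lam x₀ x z‖ₑ ∂(c.π x i)
        ≤ ∫⁻ z in ball 0 1, ENNReal.ofReal W * ENNReal.ofReal (‖z‖ ^ 2) ∂(c.π x i) := by
          refine setLIntegral_mono' measurableSet_ball fun z hz => ?_
          rw [← ENNReal.ofReal_mul hW0, Real.enorm_eq_ofReal_abs]
          exact ENNReal.ofReal_le_ofReal (abs_gaussJump_le hlam x (mem_ball_zero_iff.1 hz))
      _ = ENNReal.ofReal W * ∫⁻ z in ball 0 1, ENNReal.ofReal (‖z‖ ^ 2) ∂(c.π x i) :=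
          lintegral_const_mul _ (by fun_prop)
      _ ≤ ENNReal.ofReal W * ENNReal.ofReal (C * (1 + ‖x‖ ^ 2)) := by gcongr; exact hsmall x i
      _ = ENNReal.ofReal (W * (C * (1 + ‖x‖ ^ 2))) := (ENNReal.ofReal_mul hW0).symm
      _ ≤ _ := by
          refine ENNReal.ofReal_le_ofReal ?_
          have h1 : 1 + ‖x‖ ^ 2 ≤ (1 + ‖x₀‖) ^ 2 * (1 + ‖x - x₀‖) ^ 2 := by
            have h2 : ‖x‖ ≤ ‖x₀‖ + ‖x - x₀‖ := by simpa using norm_add_le x₀ (x - x₀)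
            have h3 : 1 + ‖x‖ ≤ (1 + ‖x₀‖) * (1 + ‖x - x₀‖) := by
              nlinarith [mul_nonneg (norm_nonneg x₀) (norm_nonneg (x - x₀))]
            rw [← mul_pow]
            calc 1 + ‖x‖ ^ 2 ≤ (1 + ‖x‖) ^ 2 := by nlinarith [norm_nonneg x]
              _ ≤ _ := by gcongr
          calc W * (C * (1 + ‖x‖ ^ 2))
              ≤ W * (C * ((1 + ‖x₀‖) ^ 2 * (1 + ‖x - x₀‖) ^ 2)) := by gcongr
            _ = C * (1 + ‖x₀‖) ^ 2 * (4 * lam ^ 2 + lam) * ((1 + ‖x - x₀‖) ^ 4 *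
                Real.exp (-lam * ‖x - x₀‖ ^ 2 + 2 * lam * ‖x - x₀‖)) := by rw [hW]; ring
            _ ≤ _ := by gcongr; exact poly_mul_exp_le hlam (norm_nonneg _)
  · calc ∫⁻ z in (ball 0 1)ᶜ, ‖gaussJump lam x₀ x z‖ₑ ∂(c.π x i)
        ≤ ∫⁻ z in (ball (0 : Rd d) 1)ᶜ, 1 ∂(c.π x i) := by
          refine setLIntegral_mono' measurableSet_ball.compl fun z hz => ?_
          rw [Real.enorm_eq_ofReal_abs]
          refine ENNReal.ofReal_le_one.2 (abs_gaussJump_le_one hlam.le x ?_)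
          simpa using hz
      _ ≤ C' := by simpa using hbig x i

lemma integrable_gaussJump (hc : c.Standing) (hlam : 0 < lam) (x₀ x : Rd d) (i : Fin m) :
    Integrable (gaussJump lam x₀ x) (c.π x i) := by
  obtain ⟨K, hK⟩ := exists_lintegral_gaussJump_le hc hlam x₀
  exact ⟨(measurable_gaussJump.comp measurable_prodMk_left).aestronglyMeasurable,
    (hK x i).trans_lt ENNReal.coe_lt_top⟩

lemma abs_a_le {C : ℝ} {x : Rd d} {i : Fin m} (h : ∑ k, ∑ l, |c.sig x i k l| ≤ C) (k l : Fin d) :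
    |c.a x i k l| ≤ C ^ 2 := by
  have hrow : ∀ k, ∑ j, |c.sig x i k j| ≤ C := fun k =>
    (Finset.single_le_sum (f := fun k => ∑ l, |c.sig x i k l|)
      (fun _ _ => Finset.sum_nonneg fun _ _ => abs_nonneg _) (Finset.mem_univ k)).trans h
  have hC : 0 ≤ C := (Finset.sum_nonneg fun _ _ => abs_nonneg _).trans (hrow k)
  have hent : ∀ k j, |c.sig x i k j| ≤ C := fun k j =>
    (Finset.single_le_sum (f := fun l => |c.sig x i k l|) (fun _ _ => abs_nonneg _)
      (Finset.mem_univ j)).trans (hrow k)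
  rw [Coeff.a, mul_apply]
  calc |∑ j, c.sig x i k j * (c.sig x i)ᵀ j l|
      ≤ ∑ j, |c.sig x i k j * (c.sig x i)ᵀ j l| := Finset.abs_sum_le_sum_abs _ _
    _ ≤ ∑ j, |c.sig x i k j| * C := by
        refine Finset.sum_le_sum fun j _ => ?_
        rw [abs_mul, transpose_apply]
        exact mul_le_mul_of_nonneg_left (hent l j) (abs_nonneg _)
    _ = (∑ j, |c.sig x i k j|) * C := (Finset.sum_mul _ _ _).symm
    _ ≤ C ^ 2 := by rw [sq]; exact mul_le_mul_of_nonneg_right (hrow k) hC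

lemma exists_abs_G_gauss_le (hc : c.Standing) (hlam : 0 < lam) (x₀ : Rd d) :
    ∃ C : ℝ, ∀ x i, |c.G (fun y _ => gauss lam x₀ y) x i| ≤ C := by
  obtain ⟨C, hC, hgrowth⟩ := hc.growth
  obtain ⟨KJ, hKJ⟩ := exists_lintegral_gaussJump_le hc hlam x₀
  set K := Real.exp ((4 + 2 * lam) ^ 2 / (4 * lam)) with hK
  set A := C * (1 + ‖x₀‖) with hA
  have hA0 : 0 < A := by positivity
  refine ⟨(2 * lam ^ 2 * (∑ _k : Fin d, ∑ _l : Fin d, A ^ 2) + lam * (∑ _k : Fin d, A ^ 2)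
    + 2 * lam * ∑ _k : Fin d, A) * K + KJ, fun x i => ?_⟩
  have hg := gauss_pos (lam := lam) (x₀ := x₀) x
  have hs := norm_nonneg (x - x₀)
  have hp := poly_mul_gauss_le (x₀ := x₀) hlam x
  have hx : C * (1 + ‖x‖) ≤ A * (1 + ‖x - x₀‖) := by
    have h2 : ‖x‖ ≤ ‖x₀‖ + ‖x - x₀‖ := by simpa using norm_add_le x₀ (x - x₀)
    have h3 : 1 + ‖x‖ ≤ (1 + ‖x₀‖) * (1 + ‖x - x₀‖) := by
      nlinarith [mul_nonneg (norm_nonneg x₀) hs]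
    rw [hA, mul_assoc]
    gcongr
  have hcoord : ∀ k, |(x - x₀) k| ≤ ‖x - x₀‖ := fun k => by
    simpa using PiLp.norm_apply_le (x - x₀) k
  set s := ‖x - x₀‖ with hsdef
  have hsig0 : 0 ≤ ∑ k, ∑ l, |c.sig x i k l| :=
    Finset.sum_nonneg fun _ _ => Finset.sum_nonneg fun _ _ => abs_nonneg _
  have hb0 : 0 ≤ ∑ k, |c.b x i k| := Finset.sum_nonneg fun _ _ => abs_nonneg _
  have ha : ∀ k l, |c.a x i k l| ≤ (A * (1 + s)) ^ 2 :=
    abs_a_le (by linarith [hgrowth x i])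
  have hb : ∀ k, |c.b x i k| ≤ A * (1 + s) := fun k => by
    have := Finset.single_le_sum (f := fun k => |c.b x i k|) (fun _ _ => abs_nonneg _)
      (Finset.mem_univ k)
    linarith [hgrowth x i]
  have e1 : 1 ≤ 1 + s := by linarith
  have t1 : |∑ k, ∑ l, (x - x₀) k * c.a x i k l * (x - x₀) l| ≤
      (∑ _k : Fin d, ∑ _l : Fin d, A ^ 2) * (1 + s) ^ 4 := by
    rw [Finset.sum_mul]
    refine (Finset.abs_sum_le_sum_abs _ _).trans (Finset.sum_le_sum fun k _ => ?_)
    rw [Finset.sum_mul]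
    refine (Finset.abs_sum_le_sum_abs _ _).trans (Finset.sum_le_sum fun l _ => ?_)
    rw [abs_mul, abs_mul]
    calc _ ≤ (1 + s) * (A * (1 + s)) ^ 2 * (1 + s) := by
          gcongr
          · linarith [hcoord k]
          · exact ha k l
          · linarith [hcoord l]
      _ = _ := by ring
  have t2 : |∑ k, c.a x i k k| ≤ (∑ _k : Fin d, A ^ 2) * (1 + s) ^ 4 := by
    rw [Finset.sum_mul]
    refine (Finset.abs_sum_le_sum_abs _ _).trans (Finset.sum_le_sum fun k _ => ?_)
    refine (ha k k).trans ?_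
    rw [mul_pow]
    gcongr
    norm_num
  have t3 : |∑ k, c.b x i k * (x - x₀) k| ≤ (∑ _k : Fin d, A) * (1 + s) ^ 4 := by
    rw [Finset.sum_mul]
    refine (Finset.abs_sum_le_sum_abs _ _).trans (Finset.sum_le_sum fun k _ => ?_)
    rw [abs_mul]
    calc _ ≤ (A * (1 + s)) * (1 + s) := by
          gcongr
          · exact hb k
          · linarith [hcoord k]
      _ = A * (1 + s) ^ 2 := by ring
      _ ≤ _ := by
        gcongr
        norm_num
  have t4 : |∫ z, gaussJump lam x₀ x z ∂(c.π x i)| ≤ KJ := by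
    rw [← Real.norm_eq_abs]
    refine (norm_integral_le_lintegral_norm _).trans ?_
    refine ENNReal.toReal_le_of_le_ofReal KJ.2 ?_
    simpa only [ofReal_norm, ENNReal.ofReal_coe_nnreal] using hKJ x i
  rw [G_gauss hc]
  refine (abs_add_le _ _).trans (add_le_add ?_ t4)
  rw [abs_mul, abs_of_pos hg]
  set S1 := ∑ k, ∑ l, (x - x₀) k * c.a x i k l * (x - x₀) l
  set S2 := ∑ k, c.a x i k k
  set S3 := ∑ k, c.b x i k * (x - x₀) k
  set N1 := ∑ _k : Fin d, ∑ _l : Fin d, A ^ 2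
  set N2 := ∑ _k : Fin d, A ^ 2
  set N3 := ∑ _k : Fin d, A
  have hN1 : 0 ≤ N1 := Finset.sum_nonneg fun _ _ => Finset.sum_nonneg fun _ _ => by positivity
  have hN2 : 0 ≤ N2 := Finset.sum_nonneg fun _ _ => by positivity
  have hN3 : 0 ≤ N3 := Finset.sum_nonneg fun _ _ => by positivity
  have hsum : |2 * lam ^ 2 * S1 - lam * S2 - 2 * lam * S3| ≤
      (2 * lam ^ 2 * N1 + lam * N2 + 2 * lam * N3) * (1 + s) ^ 4 := by
    calc _ ≤ |2 * lam ^ 2 * S1| + |lam * S2| + |2 * lam * S3| :=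
          (abs_sub _ _).trans (add_le_add_left (abs_sub _ _) _)
      _ = 2 * lam ^ 2 * |S1| + lam * |S2| + 2 * lam * |S3| := by
          rw [abs_mul, abs_mul lam, abs_mul (2 * lam), abs_of_pos hlam,
            abs_of_pos (by positivity : 0 < 2 * lam), abs_of_pos (by positivity : 0 < 2 * lam ^ 2)]
      _ ≤ 2 * lam ^ 2 * (N1 * (1 + s) ^ 4) + lam * (N2 * (1 + s) ^ 4)
          + 2 * lam * (N3 * (1 + s) ^ 4) := by gcongr
      _ = _ := by ring
  calc _ ≤ gauss lam x₀ x * ((2 * lam ^ 2 * N1 + lam * N2 + 2 * lam * N3) * (1 + s) ^ 4) :=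
        mul_le_mul_of_nonneg_left hsum hg.le
    _ = (2 * lam ^ 2 * N1 + lam * N2 + 2 * lam * N3) * ((1 + s) ^ 4 * gauss lam x₀ x) := by ring
    _ ≤ _ := by gcongr

/-- The truncated second moment of the jump measure is locally bounded. -/
lemma exists_integral_min_le (hc : c.Standing) (R : ℝ) :
    ∃ K : ℝ, 0 ≤ K ∧ ∀ x : Rd d, ‖x‖ ≤ R → ∀ i,
      Integrable (fun z : Rd d => min 1 (‖z‖ ^ 2)) (c.π x i) ∧
        ∫ z, min 1 (‖z‖ ^ 2) ∂(c.π x i) ≤ K := by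
  obtain ⟨n, hn⟩ := exists_nat_gt (max R 0)
  have hn1 : 1 ≤ n := by
    have : (0 : ℝ) < n := (le_max_right _ _).trans_lt hn
    exact_mod_cast this
  obtain ⟨Pin, -, hfin, hdom⟩ := hc.domination n hn1
  refine ⟨_, ENNReal.toReal_nonneg (a := ∫⁻ z, ENNReal.ofReal (min 1 (‖z‖ ^ 2)) ∂Pin), ?_⟩
  intro x hx i
  have hle : ∫⁻ z, ENNReal.ofReal (min 1 (‖z‖ ^ 2)) ∂(c.π x i) ≤
      ∫⁻ z, ENNReal.ofReal (min 1 (‖z‖ ^ 2)) ∂Pin :=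
    lintegral_mono' (hdom x (by
      rw [mem_ball_zero_iff]; exact (hx.trans (le_max_left _ _)).trans_lt hn) i) le_rfl
  have hnn : ∀ z : Rd d, 0 ≤ min 1 (‖z‖ ^ 2) := fun z => by positivity
  have hmeas : AEStronglyMeasurable (fun z : Rd d => min 1 (‖z‖ ^ 2)) (c.π x i) := by fun_prop
  constructor
  · refine ⟨hmeas, ?_⟩
    rw [hasFiniteIntegral_iff_ofReal (Eventually.of_forall hnn)]
    exact hle.trans_lt hfin
  · rw [integral_eq_lintegral_of_nonneg_ae (Eventually.of_forall hnn) hmeas]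
    exact ENNReal.toReal_mono hfin.ne hle

/-- For large `lam`, the Gaussian is a strict subsolution on an annulus. -/
lemma exists_gauss_subsolution (hc : c.Standing) (x₀ : Rd d) {r : ℝ} (hr : 0 < r) (R : ℝ) :
    ∃ lam > 0, ∃ ε > 0, ∀ x : Rd d, r ≤ ‖x - x₀‖ → ‖x - x₀‖ ≤ R → ∀ i,
      ε ≤ c.G (fun y _ => gauss lam x₀ y) x i := by
  rcases lt_or_ge R r with hRr | hRr
  · exact ⟨1, one_pos, 1, one_pos, fun x h1 h2 => absurd (h1.trans h2) hRr.not_ge⟩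
  have hR : 0 < R := hr.trans_le hRr
  have hdom : BddDomain (ball x₀ (R + 1)) :=
    ⟨isOpen_ball, (convex_ball _ _).isConnected (nonempty_ball.2 (by linarith)), isBounded_ball⟩
  obtain ⟨κ, ⟨hκ0, hκ1⟩, hell⟩ := hc.ellipticity _ hdom
  obtain ⟨C, hC, hgrowth⟩ := hc.growth
  obtain ⟨K3, hK3, hjump⟩ := exists_integral_min_le hc (‖x₀‖ + R)
  set K1 : ℝ := ∑ _k : Fin d, κ⁻¹ with hK1def
  set K2 := C * (1 + (‖x₀‖ + R)) * R with hK2def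
  have hK1 : 0 ≤ K1 := Finset.sum_nonneg fun _ _ => by positivity
  have hK2 : 0 ≤ K2 := by positivity
  have hden : 0 < 2 * κ * r ^ 2 := by positivity
  set lam := 1 + (K1 + 2 * K2 + 2 * K3 + 1) / (2 * κ * r ^ 2) with hlam
  have hlam1 : 1 ≤ lam := by
    rw [hlam]; have : 0 ≤ (K1 + 2 * K2 + 2 * K3 + 1) / (2 * κ * r ^ 2) := by positivity
    linarith
  have hlamK : K1 + 2 * K2 + 2 * K3 + 1 ≤ lam * (2 * κ * r ^ 2) := by
    rw [hlam, add_mul, div_mul_cancel₀ _ hden.ne']; linarith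
  have hlam0 : 0 < lam := by linarith
  refine ⟨lam, hlam0, Real.exp (-lam * R ^ 2), Real.exp_pos _, fun x hxr hxR i => ?_⟩
  have hg := gauss_pos (lam := lam) (x₀ := x₀) x
  have hxD : x ∈ ball x₀ (R + 1) := by rw [mem_ball, dist_eq_norm]; linarith
  have hxn : ‖x‖ ≤ ‖x₀‖ + R := by
    have : ‖x‖ ≤ ‖x₀‖ + ‖x - x₀‖ := by simpa using norm_add_le x₀ (x - x₀)
    linarith
  have hcoord : ∀ k, |(x - x₀) k| ≤ R := fun k => by
    refine le_trans ?_ hxR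
    simpa using PiLp.norm_apply_le (x - x₀) k
  have t1 : κ * r ^ 2 ≤ ∑ k, ∑ l, (x - x₀) k * c.a x i k l * (x - x₀) l := by
    refine le_trans ?_ (hell x hxD i (x - x₀)).1
    gcongr
  have t2 : ∑ k, c.a x i k k ≤ K1 := by
    refine Finset.sum_le_sum fun k _ => ?_
    have := (hell x hxD i (EuclideanSpace.single k (1 : ℝ))).2
    simpa [Finset.sum_ite_eq, PiLp.single_apply] using this
  have t3 : ∑ k, c.b x i k * (x - x₀) k ≤ K2 := by
    calc ∑ k, c.b x i k * (x - x₀) k ≤ ∑ k, |c.b x i k| * R := by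
          refine Finset.sum_le_sum fun k _ => (le_abs_self _).trans ?_
          rw [abs_mul]
          exact mul_le_mul_of_nonneg_left (hcoord k) (abs_nonneg _)
      _ = (∑ k, |c.b x i k|) * R := (Finset.sum_mul _ _ _).symm
      _ ≤ _ := by
          rw [hK2def]
          gcongr
          have h0 : 0 ≤ ∑ k, ∑ l, |c.sig x i k l| :=
            Finset.sum_nonneg fun _ _ => Finset.sum_nonneg fun _ _ => abs_nonneg _
          have h1 : C * (1 + ‖x‖) ≤ C * (1 + (‖x₀‖ + R)) := by gcongr
          linarith [hgrowth x i]
  have t4 : -((lam + 1) * gauss lam x₀ x) * K3 ≤ ∫ z, gaussJump lam x₀ x z ∂(c.π x i) := by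
    obtain ⟨hint, hle⟩ := hjump x hxn i
    calc -((lam + 1) * gauss lam x₀ x) * K3
        ≤ -((lam + 1) * gauss lam x₀ x) * ∫ z, min 1 (‖z‖ ^ 2) ∂(c.π x i) :=
          mul_le_mul_of_nonpos_left hle (by rw [neg_nonpos]; positivity)
      _ = ∫ z, -((lam + 1) * gauss lam x₀ x) * min 1 (‖z‖ ^ 2) ∂(c.π x i) :=
          (integral_const_mul _ _).symm
      _ ≤ _ := integral_mono (hint.const_mul _) (integrable_gaussJump hc hlam0 x₀ x i)
          fun z => neg_le_gaussJump hlam0.le x z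
  have hgl : Real.exp (-lam * R ^ 2) ≤ gauss lam x₀ x := by
    apply Real.exp_le_exp.2
    have : ‖x - x₀‖ ^ 2 ≤ R ^ 2 := by gcongr
    nlinarith
  rw [G_gauss hc]
  set S1 := ∑ k, ∑ l, (x - x₀) k * c.a x i k l * (x - x₀) l
  set S2 := ∑ k, c.a x i k k
  set S3 := ∑ k, c.b x i k * (x - x₀) k
  have hbr : 1 ≤ 2 * lam ^ 2 * S1 - lam * S2 - 2 * lam * S3 - (lam + 1) * K3 := by
    have u1 : lam * (lam * (2 * κ * r ^ 2)) ≤ 2 * lam ^ 2 * S1 := by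
      nlinarith [mul_le_mul_of_nonneg_left t1 (by positivity : 0 ≤ 2 * lam ^ 2)]
    have u2 := mul_le_mul_of_nonneg_left t2 hlam0.le
    have u3 := mul_le_mul_of_nonneg_left t3 hlam0.le
    have u4 := mul_le_mul_of_nonneg_left hlamK hlam0.le
    have u5 := mul_le_mul_of_nonneg_right hlam1 hK3
    linarith
  nlinarith [mul_le_mul_of_nonneg_left hbr hg.le]

end Coeff

/-! ### Uniform lower bound for hitting probabilities -/

namespace CadlagPath

variable {d m : ℕ} {c : Coeff d m} {lam : ℝ} {x₀ : Rd d}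

lemma intervalIntegrable_G_gauss (hc : c.Standing) (hlam : 0 < lam) (w : CadlagPath d m)
    (a b : ℝ) : IntervalIntegrable (fun u : ℝ => c.G (fun y _ => gauss lam x₀ y)
      (X u.toNNReal w) (Λ u.toNNReal w)) volume a b := by
  obtain ⟨C, hC⟩ := Coeff.exists_abs_G_gauss_le hc hlam x₀
  have hw : Measurable w.1 := measurable_of_rightContinuous w.2.1
  have hmeas : Measurable fun u : ℝ => c.G (fun y _ => gauss lam x₀ y)
      (X u.toNNReal w) (Λ u.toNNReal w) :=
    (Coeff.measurable_G_gauss hc).comp (hw.comp measurable_real_toNNReal)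
  rw [intervalIntegrable_iff]
  exact Measure.integrableOn_of_bounded (M := C) (by simp) hmeas.aestronglyMeasurable
    (Eventually.of_forall fun u => hC _ _)

/-- The process of the martingale problem for the Gaussian barrier. -/
noncomputable def gaussMart (c : Coeff d m) (lam : ℝ) (x₀ : Rd d) (t : ℝ≥0)
    (w : CadlagPath d m) : ℝ :=
  gauss lam x₀ (X t w) - gauss lam x₀ (X 0 w) -
    ∫ u in (0 : ℝ)..(t : ℝ), c.G (fun y _ => gauss lam x₀ y) (X u.toNNReal w) (Λ u.toNNReal w)

lemma gaussMart_rightContinuous (hc : c.Standing) (hlam : 0 < lam) (w : CadlagPath d m) (t : ℝ≥0) :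
    ContinuousWithinAt (fun s => gaussMart c lam x₀ s w) (Ici t) t := by
  refine ContinuousWithinAt.sub (ContinuousWithinAt.sub ?_ continuousWithinAt_const) ?_
  · exact continuous_gauss.continuousAt.comp_continuousWithinAt (X_rightContinuous w t)
  · exact ((intervalIntegral.continuous_primitive (intervalIntegrable_G_gauss hc hlam w) 0).comp
      NNReal.continuous_coe).continuousWithinAt

lemma exists_abs_gaussMart_le (hc : c.Standing) (hlam : 0 < lam) (T : ℝ≥0) :
    ∃ K : ℝ, ∀ s ≤ T, ∀ w, |gaussMart c lam x₀ s w| ≤ K := by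
  obtain ⟨C, hC⟩ := Coeff.exists_abs_G_gauss_le hc hlam x₀
  refine ⟨1 + |C| * T, fun s hs w => ?_⟩
  have h1 := gauss_pos (lam := lam) (x₀ := x₀) (X s w)
  have h2 := gauss_pos (lam := lam) (x₀ := x₀) (X 0 w)
  have h3 := gauss_le_one (x₀ := x₀) hlam.le (X s w)
  have h4 := gauss_le_one (x₀ := x₀) hlam.le (X 0 w)
  refine (abs_sub _ _).trans (add_le_add ?_ ?_)
  · rw [abs_le]; constructor <;> linarith
  · have h := intervalIntegral.norm_integral_le_of_norm_le_const (a := 0) (b := (s : ℝ)) (C := |C|)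
      (f := fun u : ℝ => c.G (fun y _ => gauss lam x₀ y) (X u.toNNReal w) (Λ u.toNNReal w))
      fun u _ => (hC _ _).trans (le_abs_self C)
    rw [Real.norm_eq_abs, sub_zero, abs_of_nonneg s.coe_nonneg] at h
    refine h.trans (mul_le_mul_of_nonneg_left ?_ (abs_nonneg _))
    exact_mod_cast hs

/-- If the barrier is a strict subsolution on the annulus `r ≤ |x - x₀| ≤ R`, then at the exit
time of the annulus, truncated at `1 / ε`, its martingale is controlled by the event of having
reached `closedBall x₀ r`. -/
lemma gaussMart_stopped_le (hc : c.Standing) (hlam : 0 < lam) {r R ε : ℝ} (hR : 0 ≤ R) (hε : 0 < ε)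
    (hsub : ∀ x : Rd d, r ≤ ‖x - x₀‖ → ‖x - x₀‖ ≤ R → ∀ i,
      ε ≤ c.G (fun y _ => gauss lam x₀ y) x i)
    {E : Set (Rd d)} (hE : closedBall x₀ r ⊆ E) (w : CadlagPath d m) {τ : ℝ≥0}
    (hτ : (τ : ℝ≥0∞) = min (hit (ball x₀ r ∪ (closedBall x₀ R)ᶜ) w) ((1 / ε).toNNReal : ℝ≥0)) :
    gaussMart c lam x₀ τ w ≤ {w | hit E w < ⊤}.indicator (fun _ => (1 : ℝ)) w
      + Real.exp (-lam * R ^ 2) - gauss lam x₀ (X 0 w) := by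
  set U := ball x₀ r ∪ (closedBall x₀ R)ᶜ with hU
  have hint : ε * τ ≤ ∫ u in (0 : ℝ)..(τ : ℝ),
      c.G (fun y _ => gauss lam x₀ y) (X u.toNNReal w) (Λ u.toNNReal w) := by
    have h : ∫ _ in (0 : ℝ)..(τ : ℝ), ε ≤ ∫ u in (0 : ℝ)..(τ : ℝ),
        c.G (fun y _ => gauss lam x₀ y) (X u.toNNReal w) (Λ u.toNNReal w) := by
      refine intervalIntegral.integral_mono_on_of_le_Ioo τ.2 intervalIntegrable_const
        (intervalIntegrable_G_gauss hc hlam w _ _) fun u hu => ?_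
      have hlt : ((u.toNNReal : ℝ≥0) : ℝ≥0∞) < hit U w := by
        refine lt_of_lt_of_le ?_ (hτ.le.trans (min_le_left _ _))
        rw [ENNReal.coe_lt_coe, Real.toNNReal_lt_iff_lt_coe hu.1.le]
        exact hu.2
      have hn := notMem_of_lt_hit hlt
      simp only [hU, mem_union, mem_ball, mem_compl_iff, mem_closedBall, dist_eq_norm, not_or,
        not_lt, not_not] at hn
      exact hsub _ hn.1 hn.2 _
    simpa [mul_comm] using h
  have hnn : 0 ≤ ε * (τ : ℝ) := by positivity
  have hexp := Real.exp_pos (-lam * R ^ 2)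
  have hind : 0 ≤ {w | hit E w < ⊤}.indicator (fun _ => (1 : ℝ)) w :=
    indicator_nonneg (fun _ _ => zero_le_one) _
  have hone := gauss_le_one (x₀ := x₀) hlam.le (X τ w)
  unfold gaussMart
  rcases le_total (hit U w) ((1 / ε).toNNReal : ℝ≥0) with hle | hle
  · rw [min_eq_left hle] at hτ
    have hcl : X τ w ∈ closedBall x₀ r ∪ (ball x₀ R)ᶜ := by
      refine closure_minimal ?_ (isClosed_closedBall.union isOpen_ball.isClosed_compl)
        (X_hit_mem_closure hτ.symm)
      exact union_subset_union ball_subset_closedBall (compl_subset_compl.2 ball_subset_closedBall)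
    rcases hcl with hin | hout
    · have hmem : w ∈ {w | hit E w < ⊤} := hit_lt_top_iff.2 ⟨τ, hE hin⟩
      rw [indicator_of_mem hmem]
      linarith
    · have hn : R ≤ ‖X τ w - x₀‖ := by simpa [dist_eq_norm] using hout
      have : gauss lam x₀ (X τ w) ≤ Real.exp (-lam * R ^ 2) := by
        apply Real.exp_le_exp.2
        have : R ^ 2 ≤ ‖X τ w - x₀‖ ^ 2 := by gcongr
        nlinarith
      linarith
  · rw [min_eq_right hle, ENNReal.coe_inj] at hτ
    have : ε * (τ : ℝ) = 1 := by
      rw [hτ, Real.coe_toNNReal _ (by positivity), mul_one_div_cancel hε.ne']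
    linarith

variable {P : Kernel (Rd d × Fin m) (CadlagPath d m)}

lemma exists_hit_prob_ge (hc : c.Standing) (hP : IsSwitchingJumpDiffusion c P) {E : Set (Rd d)}
    (hE : IsOpen E) (hx₀ : x₀ ∈ E) {R₀ : ℝ} (hR₀ : 0 ≤ R₀) :
    ∃ δ > (0 : ℝ), ∀ x : Rd d, ‖x - x₀‖ ≤ R₀ → ∀ i,
      ENNReal.ofReal δ ≤ P (x, i) {w | hit E w < ⊤} := by
  obtain ⟨r, hr, hrE⟩ := nhds_basis_closedBall.mem_iff.1 (hE.mem_nhds hx₀)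
  obtain ⟨lam, hlam, ε, hε, hsub⟩ := Coeff.exists_gauss_subsolution hc x₀ hr (R₀ + 1)
  refine ⟨Real.exp (-lam * R₀ ^ 2) - Real.exp (-lam * (R₀ + 1) ^ 2), ?_, fun x hx i => ?_⟩
  · rw [gt_iff_lt, sub_pos]
    apply Real.exp_lt_exp.2
    nlinarith [mul_nonneg hlam.le hR₀]
  have := hP.prob
  have hsol := hP.solves (x, i)
  have hmart : Martingale (gaussMart c lam x₀) (filtration d m) (P (x, i)) :=
    hsol.mart (fun y _ => gauss lam x₀ y) (fun _ => contDiff_gauss)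
      (fun _ => gauss_bounded_derivatives hlam) (Coeff.exists_abs_G_gauss_le hc hlam x₀)
  set U := ball x₀ r ∪ (closedBall x₀ (R₀ + 1))ᶜ with hU
  have hUo : IsOpen U := isOpen_ball.union isClosed_closedBall.isOpen_compl
  set T : ℝ≥0 := (1 / ε).toNNReal with hT
  let τ : CadlagPath d m → ℝ≥0 := fun w => (min (hit U w) (T : ℝ≥0∞)).toNNReal
  have hτ : ∀ w, (τ w : ℝ≥0∞) = min (hit U w) (T : ℝ≥0∞) := fun w =>
    ENNReal.coe_toNNReal (ne_top_of_le_ne_top ENNReal.coe_ne_top (min_le_right _ _))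
  have hτT : ∀ w, τ w ≤ T := fun w => by
    rw [← ENNReal.coe_le_coe, hτ]; exact min_le_right _ _
  have hst : IsStoppingTime (filtration d m) fun w => (τ w : WithTop ℝ≥0) := by
    have h := (isStoppingTime_hit (m := m) hUo).min_const T
    have heq : (fun w : CadlagPath d m => (τ w : WithTop ℝ≥0)) =
        fun w => min (hit U w : WithTop ℝ≥0) (T : WithTop ℝ≥0) := funext fun w => hτ w
    rw [heq]; exact h
  obtain ⟨K, hK⟩ := exists_abs_gaussMart_le (x₀ := x₀) hc hlam T
  obtain ⟨hint, hval⟩ := Martingale.integral_stopped_eq hmart hK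
    (gaussMart_rightContinuous hc hlam) hst hτT
  have hzero : ∫ w, gaussMart c lam x₀ T w ∂(P (x, i)) = 0 := by
    have h := hmart.setIntegral_eq (zero_le (a := T)) MeasurableSet.univ
    rw [setIntegral_univ, setIntegral_univ] at h
    rw [← h]
    simp [gaussMart]
  rw [hzero] at hval
  have hms : MeasurableSet {w : CadlagPath d m | hit E w < ⊤} := measurableSet_hit_lt_top hE
  have hinit : ∀ᵐ w ∂(P (x, i)), X 0 w = x := by
    have h1 : MeasurableSet {w : CadlagPath d m | X 0 w = x ∧ Λ 0 w = i} := by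
      have : {w : CadlagPath d m | X 0 w = x ∧ Λ 0 w = i} = (fun w => w.1 0) ⁻¹' {(x, i)} := by
        ext w; simp [X, Λ, Prod.ext_iff]
      rw [this]
      exact measurable_coord 0 (measurableSet_singleton _)
    have h2 := (prob_compl_eq_zero_iff h1).2 hsol.init
    have h3 : ∀ᵐ w ∂(P (x, i)), X 0 w = x ∧ Λ 0 w = i := h2
    filter_upwards [h3] with w hw using hw.1
  have hle : ∀ᵐ w ∂(P (x, i)), gaussMart c lam x₀ (τ w) w ≤
      {w | hit E w < ⊤}.indicator (fun _ => (1 : ℝ)) w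
        + (Real.exp (-lam * (R₀ + 1) ^ 2) - gauss lam x₀ x) := by
    filter_upwards [hinit] with w hw
    have := gaussMart_stopped_le hc hlam (by linarith) hε hsub hrE w (hτ w)
    rw [hw] at this
    linarith
  have hindint : Integrable ({w : CadlagPath d m | hit E w < ⊤}.indicator fun _ => (1 : ℝ))
      (P (x, i)) := (integrable_const 1).indicator hms
  have hmono := integral_mono_ae hint (hindint.add (integrable_const _)) hle
  rw [hval] at hmono
  simp only [Pi.add_apply] at hmono
  rw [integral_add hindint (integrable_const _), integral_indicator_const _ hms, integral_const]
    at hmono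
  simp only [smul_eq_mul, mul_one, probReal_univ, one_mul] at hmono
  have hgx : Real.exp (-lam * R₀ ^ 2) ≤ gauss lam x₀ x := by
    apply Real.exp_le_exp.2
    have : ‖x - x₀‖ ^ 2 ≤ R₀ ^ 2 := by gcongr
    nlinarith
  refine ENNReal.ofReal_le_of_le_toReal ?_
  change _ ≤ (P (x, i)).real _
  linarith

/-! ### Iteration through the strong Markov property -/

lemma hit_shift_eq_top {E : Set (Rd d)} {w : CadlagPath d m} (h : hit E w = ⊤) (t : ℝ≥0) :
    hit E (shift t w) = ⊤ := by
  by_contra hne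
  obtain ⟨s, hs⟩ := hit_lt_top_iff.1 (lt_top_iff_ne_top.2 hne)
  exact (hit_lt_top_iff.2 ⟨t + s, hs⟩).ne h

lemma measurableSet_hit_eq_top {E : Set (Rd d)} (hE : IsOpen E) :
    MeasurableSet {w : CadlagPath d m | hit E w = ⊤} := by
  have : {w : CadlagPath d m | hit E w = ⊤} = {w | hit E w < ⊤}ᶜ := by ext w; simp
  rw [this]
  exact (measurableSet_hit_lt_top hE).compl

/-- If the process a.s. reaches an open set `D` from everywhere, and the probability of missing
the open set `E` is at most `s < 1` from points of `closure D`, then `E` is a.s. reached. -/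
lemma hit_prob_eq_zero_of_le (hP : IsMarkovKernel P) (hSM : StrongMarkov P) {D E : Set (Rd d)}
    (hD : IsOpen D) (hE : IsOpen E) (hrec : ∀ z, P z {w | hit D w < ⊤} = 1) {s : ℝ≥0∞}
    (hs : s < 1) (hbound : ∀ x ∈ closure D, ∀ i, P (x, i) {w | hit E w = ⊤} ≤ s)
    (z : Rd d × Fin m) : P z {w | hit E w = ⊤} = 0 := by
  set A : Set (CadlagPath d m) := {w | hit E w = ⊤} with hA
  have hAm : MeasurableSet A := measurableSet_hit_eq_top hE
  have hall : ∀ z, P z A ≤ s := by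
    intro z
    have h := hSM z _ (isStoppingTime_hit hD) univ A MeasurableSet.univ hAm
    have hae : ∀ᵐ w ∂(P z), hit D w < ⊤ :=
      (prob_compl_eq_zero_iff (measurableSet_hit_lt_top hD)).2 (hrec z)
    calc P z A ≤ P z (univ ∩ {w | (hit D w : WithTop ℝ≥0) < ⊤ ∧
          shift (WithTop.untopD 0 (hit D w)) w ∈ A}) := by
          refine measure_mono_ae ?_
          filter_upwards [hae] with w hw hwA
          exact ⟨mem_univ _, hw, hit_shift_eq_top hwA _⟩
      _ = _ := h
      _ ≤ ∫⁻ w in univ ∩ {w | hit D w < ⊤}, s ∂(P z) := by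
          refine setLIntegral_mono' (MeasurableSet.univ.inter (measurableSet_hit_lt_top hD))
            fun w hw => ?_
          have hlt : hit D w < ⊤ := hw.2
          refine hbound _ (X_hit_mem_closure ?_) _
          exact (ENNReal.coe_toNNReal hlt.ne).symm
      _ ≤ ∫⁻ _, s ∂(P z) := setLIntegral_le_lintegral _ _
      _ = s := by simp
  have htime : ∀ n : ℕ, P z A ≤ s * P z {w | hit E w ≤ ((n : ℝ≥0) : ℝ≥0∞)}ᶜ := by
    intro n
    set B : Set (CadlagPath d m) := {w | hit E w ≤ ((n : ℝ≥0) : ℝ≥0∞)}ᶜ with hB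
    have hBF : MeasurableSet[filtration d m (n : ℝ≥0)] B :=
      ((isStoppingTime_hit hE) (n : ℝ≥0)).compl
    have hc := isStoppingTime_const (filtration d m) (n : ℝ≥0)
    have hBm : MeasurableSet[hc.measurableSpace] B := by
      rw [IsStoppingTime.measurableSpace_const]; exact hBF
    have h := hSM z _ hc B A hBm hAm
    calc P z A ≤ P z (B ∩ {w | (((n : ℝ≥0) : WithTop ℝ≥0)) < ⊤ ∧
          shift (WithTop.untopD 0 ((n : ℝ≥0) : WithTop ℝ≥0)) w ∈ A}) := by
          refine measure_mono fun w hw => ⟨?_, WithTop.coe_lt_top _, hit_shift_eq_top hw _⟩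
          have hw' : hit E w = ⊤ := hw
          simp [hB, hw']
      _ = _ := h
      _ ≤ ∫⁻ _ in B ∩ {_w | ((n : ℝ≥0) : WithTop ℝ≥0) < ⊤}, s ∂(P z) :=
          lintegral_mono fun w => hall _
      _ = s * P z (B ∩ {_w | ((n : ℝ≥0) : WithTop ℝ≥0) < ⊤}) := by simp
      _ ≤ s * P z B := by gcongr; exact inter_subset_left
  have hlim : Tendsto (fun n : ℕ => P z {w | hit E w ≤ ((n : ℝ≥0) : ℝ≥0∞)}ᶜ) atTop
      (𝓝 (P z A)) := by
    have hAeq : A = ⋂ n : ℕ, {w | hit E w ≤ ((n : ℝ≥0) : ℝ≥0∞)}ᶜ := by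
      ext w
      simp only [hA, mem_ofPred_eq, mem_iInter, mem_compl_iff, not_le]
      refine ⟨fun h n => h ▸ ENNReal.coe_lt_top, fun h => ?_⟩
      by_contra hne
      obtain ⟨n, hn⟩ := ENNReal.exists_nat_gt hne
      exact absurd (h n) (by simpa using hn.le)
    rw [hAeq]
    refine tendsto_measure_iInter_atTop (fun n => ?_) ?_ ⟨0, measure_ne_top _ _⟩
    · exact ((filtration d m).le _ _ ((isStoppingTime_hit hE) (n : ℝ≥0))).compl.nullMeasurableSet
    · intro n k hnk
      refine compl_subset_compl.2 fun w hw => ?_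
      exact le_trans (show hit E w ≤ _ from hw) (by exact_mod_cast hnk)
  have hfinal : P z A ≤ s * P z A :=
    ge_of_tendsto' (ENNReal.Tendsto.const_mul hlim (Or.inr (hs.trans ENNReal.one_lt_top).ne)) htime
  by_contra hne
  have : s * P z A < 1 * P z A :=
    ENNReal.mul_lt_mul_left hne (measure_ne_top _ _) hs
  rw [one_mul] at this
  exact this.not_ge hfinal

end CadlagPath

theorem recurrence_independent_of_domain {d m : ℕ} (hd : 1 ≤ d) (hm : 1 ≤ m)
    (c : Coeff d m) (hc : c.Standing)
    (P : Kernel (Rd d × Fin m) (CadlagPath d m)) (hP : IsSwitchingJumpDiffusion c P)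
    (hirr : ∀ U : Set (Rd d), BddDomain U → c.StrictIrred U)
    (D : Set (Rd d)) (hD : BddDomain D)
    (hrec : ∀ x ∉ D, ∀ i : Fin m, P (x, i) {w | CadlagPath.hit D w < ⊤} = 1)
    (E : Set (Rd d)) (hE : BddDomain E) :
    ∀ x ∉ E, ∀ i : Fin m, P (x, i) {w | CadlagPath.hit E w < ⊤} = 1 := by
  intro x _ i
  have := hP.prob
  have hDm := CadlagPath.measurableSet_hit_lt_top (m := m) hD.1
  have hEm := CadlagPath.measurableSet_hit_lt_top (m := m) hE.1
  have hcompl : ∀ z, P z {w | CadlagPath.hit E w = ⊤} =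
      1 - P z {w | CadlagPath.hit E w < ⊤} := by
    intro z
    rw [← prob_compl_eq_one_sub hEm]
    congr 1
    ext w
    simp
  have hrec' : ∀ z, P z {w | CadlagPath.hit D w < ⊤} = 1 := by
    rintro ⟨y, j⟩
    by_cases hy : y ∈ D
    · refine le_antisymm prob_le_one ?_
      rw [← (hP.solves (y, j)).init]
      refine measure_mono fun w hw => CadlagPath.hit_lt_top_iff.2 ⟨0, ?_⟩
      have hw1 : CadlagPath.X 0 w = y := hw.1
      rwa [hw1]
    · exact hrec y hy j
  obtain ⟨x₀, hx₀⟩ := hE.2.1.nonempty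
  obtain ⟨R, hR⟩ := hD.2.2.closure.subset_closedBall x₀
  obtain ⟨δ, hδ, hge⟩ := CadlagPath.exists_hit_prob_ge hc hP hE.1 hx₀ (le_max_right R 0)
  have hzero := CadlagPath.hit_prob_eq_zero_of_le hP.prob hP.strongMarkov hD.1 hE.1 hrec'
    (s := 1 - ENNReal.ofReal δ)
    (ENNReal.sub_lt_self ENNReal.one_ne_top one_ne_zero (ENNReal.ofReal_pos.2 hδ).ne')
    (fun y hy j => by
      rw [hcompl]
      refine tsub_le_tsub_left (hge y ?_ j) _
      rw [← dist_eq_norm]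
      exact (mem_closedBall.1 (hR hy)).trans (le_max_left _ _)) (x, i)
  rw [hcompl, tsub_eq_zero_iff_le] at hzero
  exact le_antisymm prob_le_one hzero
end
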